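/- Fix 1 < p < ∞ and let φ be a non-trivial weight on (0, ∞) with ∫₀^∞ φ(t) dt = ∞, and let ψ be its dual weight. Then there exist constants c, C > 0 such that for every g ∈ M₊((0,∞)): c·(∫₀^∞ (Sg)(t)^{p'} ψ(t) dt)^{1/p'} ≤ sup_{f ∈ Ω} (∫₀^∞ f g)/(∫₀^∞ f^p φ)^{1/p} ≤ C·(∫₀^∞ (Sg)(t)^{p'} ψ(t) dt)^{1/p'}, where Ω := {f ∈ M₊((0,∞)) : t ↦ t f(t) is increasing and f is decreasing}. -/

import Mathlib

open MeasureTheory Set ENNReal Filter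

noncomputable section

/-- The interval `I_b = (0, b)` for `b ∈ (0, ∞]`, as a subset of `ℝ`. -/
def IbSet (b : ℝ≥0∞) : Set ℝ := {t : ℝ | 0 < t ∧ ENNReal.ofReal t < b}

/-- `∫₀ᵗ φ`. -/
def intPhi (φ : ℝ → ℝ≥0∞) (t : ℝ) : ℝ≥0∞ := ∫⁻ s in Ioo (0 : ℝ) t, φ s

/-- `∫ₜᵇ φ(s) s^(-p) ds`. -/
def tailP (b : ℝ≥0∞) (p : ℝ) (φ : ℝ → ℝ≥0∞) (t : ℝ) : ℝ≥0∞ :=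
  ∫⁻ s in {s : ℝ | t < s ∧ ENNReal.ofReal s < b}, φ s * ENNReal.ofReal (s ^ (-p))

/-- `∫₀ᵗ φ + tᵖ ∫ₜᵇ φ(s) s^(-p) ds`. -/
def DPhi (b : ℝ≥0∞) (p : ℝ) (φ : ℝ → ℝ≥0∞) (t : ℝ) : ℝ≥0∞ :=
  intPhi φ t + ENNReal.ofReal (t ^ p) * tailP b p φ t

/-- The Hardy averaging operator `P`. -/
def Pavg (g : ℝ → ℝ≥0∞) (t : ℝ) : ℝ≥0∞ := (ENNReal.ofReal t)⁻¹ * ∫⁻ s in Ioo (0 : ℝ) t, g s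

/-- The dual Hardy operator `Q`, `(Qg)(t) = ∫ₜᵇ g(s) s⁻¹ ds`. -/
def Qavg (b : ℝ≥0∞) (g : ℝ → ℝ≥0∞) (t : ℝ) : ℝ≥0∞ :=
  ∫⁻ s in {s : ℝ | t < s ∧ ENNReal.ofReal s < b}, g s * (ENNReal.ofReal s)⁻¹

/-- The operator `Q_p`, `(Q_p g)(t) = p t^(p-1) ∫ₜᵇ g(s) s^(-p) ds`. -/
def Qp (b : ℝ≥0∞) (p : ℝ) (g : ℝ → ℝ≥0∞) (t : ℝ) : ℝ≥0∞ :=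
  ENNReal.ofReal (p * t ^ (p - 1)) *
    ∫⁻ s in {s : ℝ | t < s ∧ ENNReal.ofReal s < b}, g s * ENNReal.ofReal (s ^ (-p))

/-- `(PQ_p)(φ)(t) = t⁻¹ [∫₀ᵗ φ + tᵖ ∫ₜᵇ φ(s) s^(-p) ds]`. -/
def PQp (b : ℝ≥0∞) (p : ℝ) (φ : ℝ → ℝ≥0∞) (t : ℝ) : ℝ≥0∞ :=
  (ENNReal.ofReal t)⁻¹ * DPhi b p φ t

/-- A weight on `I_b`: a positive, finite, locally integrable function. -/
def IsWeight (b : ℝ≥0∞) (φ : ℝ → ℝ≥0∞) : Prop :=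
  Measurable φ ∧ (∀ t ∈ IbSet b, 0 < φ t ∧ φ t < ⊤) ∧
    ∀ a c : ℝ, 0 < a → ENNReal.ofReal c < b → ∫⁻ t in Icc a c, φ t < ⊤

/-- A non-trivial weight on `I_b` for the index `p`. -/
def IsNontrivialWeight (b : ℝ≥0∞) (p : ℝ) (φ : ℝ → ℝ≥0∞) : Prop :=
  IsWeight b φ ∧
    (b = ⊤ → ∫⁻ t in Ioi (1 : ℝ), φ t * ENNReal.ofReal (t ^ (-p)) < ⊤) ∧
    tailP b p φ 0 = ⊤

/-- The dual weight `ψ(t) = t^(p+p'-1) (∫₀ᵗ φ)(∫ₜᵇ φ(s)s^(-p) ds)/D(t)^(p'+1)`. -/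
def dualWeight (b : ℝ≥0∞) (p : ℝ) (φ : ℝ → ℝ≥0∞) (t : ℝ) : ℝ≥0∞ :=
  ENNReal.ofReal (t ^ (p + p / (p - 1) - 1)) * intPhi φ t * tailP b p φ t /
    (DPhi b p φ t) ^ (p / (p - 1) + 1)

/-- `ψ = (Pφ)(Q_pφ)/[(PQ_p)(φ)]^(p'+1)`. -/
def dualWeight' (b : ℝ≥0∞) (p : ℝ) (φ : ℝ → ℝ≥0∞) (t : ℝ) : ℝ≥0∞ :=
  Pavg φ t * Qp b p φ t / (PQp b p φ t) ^ (p / (p - 1) + 1)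

/-- The decreasing rearrangement `f*`. -/
def decRearr {α : Type*} [MeasurableSpace α] (μ : Measure α) (f : α → ℝ) (t : ℝ) : ℝ≥0∞ :=
  sInf {l : ℝ≥0∞ | μ {x | l < (‖f x‖₊ : ℝ≥0∞)} ≤ ENNReal.ofReal t}

/-- `f**(t) = t⁻¹ ∫₀ᵗ f*`. -/
def avgRearr {α : Type*} [MeasurableSpace α] (μ : Measure α) (f : α → ℝ) (t : ℝ) : ℝ≥0∞ :=
  (ENNReal.ofReal t)⁻¹ * ∫⁻ s in Ioo (0 : ℝ) t, decRearr μ f s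

/-- The Lorentz Gamma functional `ρ_{p,φ}(f) = (∫_{I_b} f**(t)^p φ(t) dt)^(1/p)`. -/
def rhoGamma {α : Type*} [MeasurableSpace α] (μ : Measure α) (b : ℝ≥0∞) (p : ℝ)
    (φ : ℝ → ℝ≥0∞) (f : α → ℝ) : ℝ≥0∞ :=
  (∫⁻ t in IbSet b, (avgRearr μ f t) ^ p * φ t) ^ (1 / p)

/-- The Stieltjes operator `(Sg)(t) = ∫₀^∞ g(s)/(s+t) ds`. -/
def Sop (g : ℝ → ℝ≥0∞) (t : ℝ) : ℝ≥0∞ :=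
  ∫⁻ s in Ioi (0 : ℝ), g s / ENNReal.ofReal (s + t)

/-- Lebesgue measure on `(0,∞)`. -/
def mu0 : Measure ℝ := volume.restrict (Ioi (0 : ℝ))

lemma ftc_Ioo (H h : ℝ → ℝ) (hd : ∀ s, 0 < s → HasDerivAt H (h s) s)
    (hc : ContinuousOn h (Ioi 0)) (h0 : ∀ s, 0 < s → 0 ≤ h s) {a b : ℝ} (ha : 0 < a) (hab : a ≤ b) :
    ∫⁻ s in Ioo a b, ENNReal.ofReal (h s) = ENNReal.ofReal (H b - H a) := by
  have hsub : Icc a b ⊆ Ioi 0 := fun x hx => lt_of_lt_of_le ha hx.1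
  have hIntg : IntegrableOn h (Icc a b) := (hc.mono hsub).integrableOn_Icc
  have e1 : ∫ s in a..b, h s = H b - H a := by
    apply intervalIntegral.integral_eq_sub_of_hasDerivAt
    · intro x hx
      rw [uIcc_of_le hab] at hx
      exact hd x (hsub hx)
    · rw [intervalIntegrable_iff_integrableOn_Icc_of_le hab]
      exact hIntg
  rw [← e1, intervalIntegral.integral_of_le hab, ofReal_integral_eq_lintegral_ofReal
    (hIntg.mono_set Ioc_subset_Icc_self)]
  · exact setLIntegral_congr Ioo_ae_eq_Ioc
  · filter_upwards [ae_restrict_mem measurableSet_Ioc] with x hx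
    exact h0 x (lt_trans ha hx.1)

lemma ftc_left_le (H h : ℝ → ℝ) (hd : ∀ s, 0 < s → HasDerivAt H (h s) s)
    (hc : ContinuousOn h (Ioi 0)) (h0 : ∀ s, 0 < s → 0 ≤ h s) (hH : ∀ s, 0 < s → 0 ≤ H s)
    {b : ℝ} (hb : 0 < b) :
    ∫⁻ s in Ioo 0 b, ENNReal.ofReal (h s) ≤ ENNReal.ofReal (H b) := by
  have hu : Ioo (0:ℝ) b = ⋃ n : ℕ, Ioo (b / (n + 1)) b := by
    ext x
    simp only [mem_Ioo, mem_iUnion, exists_and_right]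
    constructor
    · rintro ⟨h1, h2⟩
      refine ⟨?_, h2⟩
      obtain ⟨n, hn⟩ := exists_nat_gt (b / x)
      refine ⟨n, ?_⟩
      rw [div_lt_iff₀ h1] at hn
      rw [div_lt_iff₀ (by positivity)]
      nlinarith
    · rintro ⟨⟨n, hn⟩, h2⟩
      exact ⟨lt_trans (by positivity) hn, h2⟩
  rw [hu, setLIntegral_iUnion_of_directed]
  · apply iSup_le
    intro n
    have hle : b / ((n:ℝ) + 1) ≤ b := div_le_self hb.le (by linarith [n.cast_nonneg (α := ℝ)])
    rw [ftc_Ioo H h hd hc h0 (by positivity) hle]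
    apply ENNReal.ofReal_le_ofReal
    have := hH (b / ((n:ℝ)+1)) (by positivity)
    linarith
  · apply Monotone.directed_le
    intro n k hnk
    apply Ioo_subset_Ioo_left
    gcongr

lemma ftc_right_le (H h : ℝ → ℝ) (hd : ∀ s, 0 < s → HasDerivAt H (h s) s)
    (hc : ContinuousOn h (Ioi 0)) (h0 : ∀ s, 0 < s → 0 ≤ h s) (hH : ∀ s, 0 < s → H s ≤ 0)
    {a : ℝ} (ha : 0 < a) :
    ∫⁻ s in Ioi a, ENNReal.ofReal (h s) ≤ ENNReal.ofReal (- H a) := by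
  have hu : Ioi a = ⋃ n : ℕ, Ioo a (a + n) := by
    ext x
    simp only [mem_Ioo, mem_iUnion, exists_and_left, mem_Ioi]
    constructor
    · intro h1
      refine ⟨h1, ?_⟩
      obtain ⟨n, hn⟩ := exists_nat_gt (x - a)
      exact ⟨n, by linarith⟩
    · exact fun h => h.1
  rw [hu, setLIntegral_iUnion_of_directed]
  · apply iSup_le
    intro n
    have hn := n.cast_nonneg (α := ℝ)
    rw [ftc_Ioo H h hd hc h0 ha (by linarith)]
    apply ENNReal.ofReal_le_ofReal
    have := hH (a + n) (by positivity)
    linarith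
  · apply Monotone.directed_le
    intro n k hnk
    apply Ioo_subset_Ioo_right
    gcongr

lemma ftc_left_ge (H h : ℝ → ℝ) (hd : ∀ s, 0 < s → HasDerivAt H (h s) s)
    (hc : ContinuousOn h (Ioi 0)) (h0 : ∀ s, 0 < s → 0 ≤ h s)
    (hl : Tendsto H (nhdsWithin 0 (Ioi 0)) (nhds 0))
    {b : ℝ} (hb : 0 < b) :
    ENNReal.ofReal (H b) ≤ ∫⁻ s in Ioo 0 b, ENNReal.ofReal (h s) := by
  have : Tendsto (fun a => ENNReal.ofReal (H b - H a)) (nhdsWithin 0 (Ioi 0))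
      (nhds (ENNReal.ofReal (H b - 0))) :=
    ENNReal.tendsto_ofReal (tendsto_const_nhds.sub hl)
  rw [sub_zero] at this
  refine le_of_tendsto this ?_
  filter_upwards [Ioo_mem_nhdsGT hb] with a ha
  rw [← ftc_Ioo H h hd hc h0 ha.1 ha.2.le]
  exact lintegral_mono_set (Ioo_subset_Ioo_left ha.1.le)

lemma ftc_right_ge (H h : ℝ → ℝ) (hd : ∀ s, 0 < s → HasDerivAt H (h s) s)
    (hc : ContinuousOn h (Ioi 0)) (h0 : ∀ s, 0 < s → 0 ≤ h s)
    (hl : Tendsto H atTop (nhds 0))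
    {a : ℝ} (ha : 0 < a) :
    ENNReal.ofReal (- H a) ≤ ∫⁻ s in Ioi a, ENNReal.ofReal (h s) := by
  have : Tendsto (fun b => ENNReal.ofReal (H b - H a)) atTop
      (nhds (ENNReal.ofReal (0 - H a))) :=
    ENNReal.tendsto_ofReal (hl.sub tendsto_const_nhds)
  rw [zero_sub] at this
  refine le_of_tendsto this ?_
  filter_upwards [eventually_ge_atTop a] with b hb
  rw [← ftc_Ioo H h hd hc h0 ha hb]
  exact lintegral_mono_set (fun x hx => hx.1)

def Df (p : ℝ) (A B : ℝ → ℝ) (t : ℝ) : ℝ := A t + t ^ p * B t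
def Ef (p : ℝ) (A B : ℝ → ℝ) (t : ℝ) : ℝ := t ^ (-p) * A t + B t
def dd (p : ℝ) (B : ℝ → ℝ) (t : ℝ) : ℝ := p * t ^ (p - 1) * B t
def ee (p : ℝ) (A : ℝ → ℝ) (t : ℝ) : ℝ := p * t ^ (-p - 1) * A t
def zf (p : ℝ) (A B : ℝ → ℝ) (t : ℝ) : ℝ := t ^ (p - 1) * A t * B t / (Df p A B t) ^ 2

structure Setup (p : ℝ) (m : Measure ℝ) (A B Z : ℝ → ℝ) : Prop where
  hp : 1 < p
  hm0 : m (Iic 0) = 0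
  mA : Measurable A
  mB : Measurable B
  mZ : Measurable Z
  Apos : ∀ t, 0 < t → 0 < A t
  Bpos : ∀ t, 0 < t → 0 < B t
  hA : ∀ t, 0 < t → m (Ioo 0 t) = ENNReal.ofReal (A t)
  hB : ∀ t, 0 < t → ∫⁻ u in Ioi t, ENNReal.ofReal (u ^ (-p)) ∂m = ENNReal.ofReal (B t)
  Acont : ContinuousOn A (Ioi 0)
  Bcont : ContinuousOn B (Ioi 0)
  Amono : ∀ s t, 0 < s → s ≤ t → A s ≤ A t
  Banti : ∀ s t, 0 < s → s ≤ t → B t ≤ B s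
  hD : ∀ t, 0 < t → HasDerivAt (Df p A B) (dd p B t) t
  hZ : ∀ t, 0 < t → HasDerivAt Z (zf p A B t) t
  Atop : Tendsto A atTop atTop
  Bzero : Tendsto B (nhdsWithin 0 (Ioi 0)) atTop

namespace Setup
variable {p : ℝ} {m : Measure ℝ} {A B Z : ℝ → ℝ}

lemma p0 (S : Setup p m A B Z) : 0 < p := by linarith [S.hp]

lemma Dpos (S : Setup p m A B Z) {t : ℝ} (ht : 0 < t) : 0 < Df p A B t := by
  have := S.Apos t ht
  have := S.Bpos t ht
  unfold Df; positivity

lemma Epos (S : Setup p m A B Z) {t : ℝ} (ht : 0 < t) : 0 < Ef p A B t := by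
  have := S.Apos t ht
  have := S.Bpos t ht
  unfold Ef; positivity

lemma DE (t : ℝ) (ht : 0 < t) : Df p A B t = t ^ p * Ef p A B t := by
  unfold Df Ef
  rw [mul_add, ← mul_assoc, ← Real.rpow_add ht]; simp

lemma ED (t : ℝ) (ht : 0 < t) : Ef p A B t = t ^ (-p) * Df p A B t := by
  unfold Df Ef
  rw [mul_add, ← mul_assoc, ← Real.rpow_add ht]; simp

lemma AleD (S : Setup p m A B Z) {t : ℝ} (ht : 0 < t) : A t ≤ Df p A B t := by
  have := S.Bpos t ht
  have : 0 ≤ t ^ p * B t := by positivity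
  unfold Df; linarith

lemma BleE (S : Setup p m A B Z) {t : ℝ} (ht : 0 < t) : B t ≤ Ef p A B t := by
  have := S.Apos t ht
  have : 0 ≤ t ^ (-p) * A t := by positivity
  unfold Ef; linarith

lemma dpos (S : Setup p m A B Z) {t : ℝ} (ht : 0 < t) : 0 < dd p B t := by
  have := S.Bpos t ht
  have := S.p0
  unfold dd; positivity

lemma epos (S : Setup p m A B Z) {t : ℝ} (ht : 0 < t) : 0 < ee p A t := by
  have := S.Apos t ht
  have := S.p0
  unfold ee; positivity

lemma zpos (S : Setup p m A B Z) {t : ℝ} (ht : 0 < t) : 0 < zf p A B t := by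
  have := S.Apos t ht
  have := S.Bpos t ht
  have := S.Dpos ht
  unfold zf; positivity

lemma contPow (r : ℝ) : ContinuousOn (fun t : ℝ => t ^ r) (Ioi 0) :=
  fun x hx => (Real.continuousAt_rpow_const x r (Or.inl (ne_of_gt hx))).continuousWithinAt

lemma Dcont (S : Setup p m A B Z) : ContinuousOn (Df p A B) (Ioi 0) :=
  S.Acont.add ((contPow p).mul S.Bcont)

lemma Econt (S : Setup p m A B Z) : ContinuousOn (Ef p A B) (Ioi 0) :=
  ((contPow (-p)).mul S.Acont).add S.Bcont

lemma dcont (S : Setup p m A B Z) : ContinuousOn (dd p B) (Ioi 0) :=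
  ((contPow (p-1)).const_mul p).mul S.Bcont |>.congr (fun x _ => by simp [dd])

lemma econt (S : Setup p m A B Z) : ContinuousOn (ee p A) (Ioi 0) :=
  ((contPow (-p-1)).const_mul p).mul S.Acont |>.congr (fun x _ => by simp [ee])

lemma zcont (S : Setup p m A B Z) : ContinuousOn (zf p A B) (Ioi 0) :=
  (((contPow (p-1)).mul S.Acont).mul S.Bcont).div (S.Dcont.pow 2)
    (fun x hx => by have := S.Dpos hx; positivity)

lemma mD (S : Setup p m A B Z) : Measurable (Df p A B) := by
  have := S.mA; have := S.mB
  unfold Df; fun_prop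

lemma mz (S : Setup p m A B Z) : Measurable (zf p A B) := by
  have := S.mA; have := S.mB; have := S.mD
  unfold zf; fun_prop

lemma hE (S : Setup p m A B Z) {t : ℝ} (ht : 0 < t) :
    HasDerivAt (Ef p A B) (-ee p A t) t := by
  have h1 := (Real.hasDerivAt_rpow_const (x := t) (p := -p) (Or.inl ht.ne')).mul (S.hD t ht)
  have h2 : (fun t => t ^ (-p) * Df p A B t) =ᶠ[nhds t] Ef p A B := by
    filter_upwards [Ioi_mem_nhds ht] with x hx
    exact (ED x hx).symm
  refine (h1.congr_of_eventuallyEq h2.symm).congr_deriv ?_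
  unfold Df dd ee
  have e1 : t ^ (-p - 1) = t⁻¹ * t ^ (-p) := by
    rw [Real.rpow_sub_one ht.ne']; field_simp
  have e2 : t ^ (p - 1) = t⁻¹ * t ^ p := by
    rw [Real.rpow_sub_one ht.ne']; field_simp
  rw [e1, e2]; ring

/-- pointwise bounds on the density -/
lemma zD (S : Setup p m A B Z) {t : ℝ} (_ht : 0 < t) :
    zf p A B t = A t * dd p B t / (p * Df p A B t ^ 2) := by
  have := S.p0
  unfold zf dd; field_simp

lemma zE (S : Setup p m A B Z) {t : ℝ} (ht : 0 < t) :
    zf p A B t = B t * ee p A t / (p * Ef p A B t ^ 2) := by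
  have := S.p0
  have hE := S.Epos ht
  unfold zf ee
  rw [DE t ht]
  have e1 : t ^ (-p - 1) = t⁻¹ * (t ^ p)⁻¹ := by
    rw [Real.rpow_sub_one ht.ne', Real.rpow_neg ht.le]; field_simp
  have e2 : t ^ (p - 1) = t⁻¹ * t ^ p := by
    rw [Real.rpow_sub_one ht.ne']; field_simp
  rw [e1, e2]
  have : 0 < t ^ p := by positivity
  field_simp

lemma zb1 (S : Setup p m A B Z) {t : ℝ} (ht : 0 < t) :
    zf p A B t ≤ dd p B t / (p * Df p A B t) := by
  have := S.p0
  have hD := S.Dpos ht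
  have := S.dpos ht
  rw [S.zD ht, div_le_div_iff₀ (by positivity) (by positivity)]
  have : A t * (dd p B t * p * Df p A B t) ≤ Df p A B t * (dd p B t * p * Df p A B t) :=
    mul_le_mul_of_nonneg_right (S.AleD ht) (by positivity)
  nlinarith

lemma zb2 (S : Setup p m A B Z) {t : ℝ} (ht : 0 < t) :
    zf p A B t ≤ ee p A t / (p * Ef p A B t) := by
  have := S.p0
  have hD := S.Epos ht
  have := S.epos ht
  rw [S.zE ht, div_le_div_iff₀ (by positivity) (by positivity)]
  have : B t * (ee p A t * p * Ef p A B t) ≤ Ef p A B t * (ee p A t * p * Ef p A B t) :=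
    mul_le_mul_of_nonneg_right (S.BleE ht) (by positivity)
  nlinarith

lemma Az (S : Setup p m A B Z) {t : ℝ} (ht : 0 < t) : zf p A B t * A t ≤ dd p B t / p := by
  have h := S.zb1 ht
  have := S.p0
  have hD := S.Dpos ht
  have hd := S.dpos ht
  have hA := S.Apos t ht
  calc zf p A B t * A t ≤ dd p B t / (p * Df p A B t) * Df p A B t :=
        mul_le_mul h (S.AleD ht) hA.le (by positivity)
    _ = _ := by field_simp

lemma Bz (S : Setup p m A B Z) {t : ℝ} (ht : 0 < t) : zf p A B t * B t ≤ ee p A t / p := by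
  have h := S.zb2 ht
  have := S.p0
  have hD := S.Epos ht
  have hd := S.epos ht
  have hA := S.Bpos t ht
  calc zf p A B t * B t ≤ ee p A t / (p * Ef p A B t) * Ef p A B t :=
        mul_le_mul h (S.BleE ht) hA.le (by positivity)
    _ = _ := by field_simp

/-- power integrals -/
lemma derD (S : Setup p m A B Z) {r : ℝ} (hr : r ≠ 0) (s : ℝ) (hs : 0 < s) :
    HasDerivAt (fun s => Df p A B s ^ r / r) (Df p A B s ^ (r - 1) * dd p B s) s := by
  refine (((S.hD s hs).rpow_const (p := r) (Or.inl (S.Dpos hs).ne')).div_const r).congr_deriv ?_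
  field_simp

lemma derE (S : Setup p m A B Z) {r : ℝ} (hr : r ≠ 0) (s : ℝ) (hs : 0 < s) :
    HasDerivAt (fun s => -(Ef p A B s ^ r / r)) (Ef p A B s ^ (r - 1) * ee p A s) s := by
  refine (((S.hE hs).rpow_const (p := r) (Or.inl (S.Epos hs).ne')).div_const r).neg.congr_deriv ?_
  field_simp

lemma derDc (S : Setup p m A B Z) (r : ℝ) :
    ContinuousOn (fun s => Df p A B s ^ r * dd p B s) (Ioi 0) :=
  (S.Dcont.rpow_const (fun _ hx => Or.inl (S.Dpos hx).ne')).mul S.dcont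

lemma derEc (S : Setup p m A B Z) (r : ℝ) :
    ContinuousOn (fun s => Ef p A B s ^ r * ee p A s) (Ioi 0) :=
  (S.Econt.rpow_const (fun _ hx => Or.inl (S.Epos hx).ne')).mul S.econt

lemma derD0 (S : Setup p m A B Z) (r : ℝ) (s : ℝ) (hs : 0 < s) :
    0 ≤ Df p A B s ^ r * dd p B s := by
  have := S.Dpos hs; have := S.dpos hs; positivity

lemma derE0 (S : Setup p m A B Z) (r : ℝ) (s : ℝ) (hs : 0 < s) :
    0 ≤ Ef p A B s ^ r * ee p A s := by
  have := S.Epos hs; have := S.epos hs; positivity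

lemma R2_le (S : Setup p m A B Z) {r t : ℝ} (hr : 0 < r) (ht : 0 < t) :
    ∫⁻ s in Ioo 0 t, ENNReal.ofReal (Df p A B s ^ (r - 1) * dd p B s) ≤
      ENNReal.ofReal (Df p A B t ^ r / r) :=
  ftc_left_le _ _ (S.derD hr.ne') (S.derDc _) (S.derD0 _)
    (fun s hs => by have := S.Dpos hs; positivity) ht

lemma L2_le (S : Setup p m A B Z) {r t : ℝ} (hr : 0 < r) (ht : 0 < t) :
    ∫⁻ s in Ioi t, ENNReal.ofReal (Ef p A B s ^ (r - 1) * ee p A s) ≤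
      ENNReal.ofReal (Ef p A B t ^ r / r) := by
  have := ftc_right_le _ _ (S.derE hr.ne') (S.derEc _) (S.derE0 _)
    (fun s hs => by have := S.Epos hs; simp only [Left.neg_nonpos_iff]; positivity) ht
  simpa using this

lemma R1_le (S : Setup p m A B Z) {r t : ℝ} (hr : 0 < r) (ht : 0 < t) :
    ∫⁻ s in Ioi t, ENNReal.ofReal (Df p A B s ^ (-r - 1) * dd p B s) ≤
      ENNReal.ofReal (Df p A B t ^ (-r) / r) := by
  have := ftc_right_le _ _ (S.derD (neg_ne_zero.2 hr.ne')) (S.derDc _) (S.derD0 _)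
    (fun s hs => by
      have := S.Dpos hs
      simp only [div_neg, Left.neg_nonpos_iff]; positivity) ht
  simpa [div_neg] using this

lemma L1_le (S : Setup p m A B Z) {r t : ℝ} (hr : 0 < r) (ht : 0 < t) :
    ∫⁻ s in Ioo 0 t, ENNReal.ofReal (Ef p A B s ^ (-r - 1) * ee p A s) ≤
      ENNReal.ofReal (Ef p A B t ^ (-r) / r) := by
  have := ftc_left_le _ _ (S.derE (neg_ne_zero.2 hr.ne')) (S.derEc _) (S.derE0 _)
    (fun s hs => by
      have := S.Epos hs
      simp only [div_neg, neg_neg]; positivity) ht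
  simpa [div_neg] using this

lemma Dtop (S : Setup p m A B Z) : Tendsto (Df p A B) atTop atTop := by
  refine tendsto_atTop_mono' _ ?_ S.Atop
  filter_upwards [eventually_gt_atTop 0] with t ht using S.AleD ht

lemma Ezero (S : Setup p m A B Z) : Tendsto (Ef p A B) (nhdsWithin 0 (Ioi 0)) atTop := by
  refine tendsto_atTop_mono' _ ?_ S.Bzero
  filter_upwards [self_mem_nhdsWithin] with t ht using S.BleE ht

lemma R1_ge (S : Setup p m A B Z) {r t : ℝ} (hr : 0 < r) (ht : 0 < t) :
    ENNReal.ofReal (Df p A B t ^ (-r) / r) ≤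
    ∫⁻ s in Ioi t, ENNReal.ofReal (Df p A B s ^ (-r - 1) * dd p B s) := by
  have := ftc_right_ge _ _ (S.derD (neg_ne_zero.2 hr.ne')) (S.derDc _) (S.derD0 _)
    (by
      have := ((tendsto_rpow_neg_atTop hr).comp S.Dtop).div_const (-r)
      simpa using this) ht
  simpa [div_neg] using this

lemma L1_ge (S : Setup p m A B Z) {r t : ℝ} (hr : 0 < r) (ht : 0 < t) :
    ENNReal.ofReal (Ef p A B t ^ (-r) / r) ≤
    ∫⁻ s in Ioo 0 t, ENNReal.ofReal (Ef p A B s ^ (-r - 1) * ee p A s) := by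
  have := ftc_left_ge _ _ (S.derE (neg_ne_zero.2 hr.ne')) (S.derEc _) (S.derE0 _)
    (by
      have := (((tendsto_rpow_neg_atTop hr).comp S.Ezero).div_const (-r)).neg
      simpa using this) ht
  simpa [div_neg] using this

/-- comparison of `Z` with logarithms -/
lemma Zmono (S : Setup p m A B Z) {s t : ℝ} (hs : 0 < s) (hst : s ≤ t) : Z s ≤ Z t := by
  have : MonotoneOn Z (Ioi 0) := by
    apply monotoneOn_of_deriv_nonneg (convex_Ioi 0)
    · exact fun x hx => (S.hZ x hx).continuousAt.continuousWithinAt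
    · rw [interior_Ioi]
      exact fun x hx => (S.hZ x hx).differentiableAt.differentiableWithinAt
    · rw [interior_Ioi]
      intro x hx
      rw [(S.hZ x hx).deriv]
      exact (S.zpos hx).le
  exact this hs (lt_of_lt_of_le hs hst) hst

lemma ZlogD (S : Setup p m A B Z) {s t : ℝ} (hs : 0 < s) (hst : s ≤ t) :
    Z t - Z s ≤ (Real.log (Df p A B t) - Real.log (Df p A B s)) / p := by
  have hd : ∀ x, 0 < x → HasDerivAt (fun t => Real.log (Df p A B t) / p - Z t)
      (dd p B x / Df p A B x / p - zf p A B x) x := fun x hx =>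
    (((S.hD x hx).log (S.Dpos hx).ne').div_const p).sub (S.hZ x hx)
  have : MonotoneOn (fun t => Real.log (Df p A B t) / p - Z t) (Ioi 0) := by
    apply monotoneOn_of_deriv_nonneg (convex_Ioi 0)
    · exact fun x hx => (hd x hx).continuousAt.continuousWithinAt
    · rw [interior_Ioi]
      exact fun x hx => (hd x hx).differentiableAt.differentiableWithinAt
    · rw [interior_Ioi]
      intro x hx
      rw [(hd x hx).deriv]
      have := S.zb1 hx
      rw [div_div, mul_comm (Df p A B x)]
      linarith
  have := this hs (lt_of_lt_of_le hs hst) hst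
  simp only at this
  rw [sub_div]; linarith

lemma ZlogE (S : Setup p m A B Z) {s t : ℝ} (hs : 0 < s) (hst : s ≤ t) :
    Z t - Z s ≤ (Real.log (Ef p A B s) - Real.log (Ef p A B t)) / p := by
  have hd : ∀ x, 0 < x → HasDerivAt (fun t => -(Real.log (Ef p A B t) / p) - Z t)
      (-(-ee p A x / Ef p A B x / p) - zf p A B x) x := fun x hx =>
    (((S.hE hx).log (S.Epos hx).ne').div_const p).neg.sub (S.hZ x hx)
  have : MonotoneOn (fun t => -(Real.log (Ef p A B t) / p) - Z t) (Ioi 0) := by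
    apply monotoneOn_of_deriv_nonneg (convex_Ioi 0)
    · exact fun x hx => (hd x hx).continuousAt.continuousWithinAt
    · rw [interior_Ioi]
      exact fun x hx => (hd x hx).differentiableAt.differentiableWithinAt
    · rw [interior_Ioi]
      intro x hx
      rw [(hd x hx).deriv]
      have := S.zb2 hx
      rw [div_div, mul_comm (Ef p A B x), neg_div, neg_neg]
      linarith
  have := this hs (lt_of_lt_of_le hs hst) hst
  simp only at this
  rw [sub_div]; linarith

end Setup

lemma split_at (μ : Measure ℝ) [NullSingletonClass μ] (F : ℝ → ℝ≥0∞) {t : ℝ} (ht : 0 < t) :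
    ∫⁻ s in Ioi 0, F s ∂μ = ∫⁻ s in Ioo 0 t, F s ∂μ + ∫⁻ s in Ioi t, F s ∂μ := by
  rw [← Ioo_union_Ici_eq_Ioi ht, lintegral_union measurableSet_Ici]
  · congr 1
    exact setLIntegral_congr Ioi_ae_eq_Ici.symm
  · rw [Set.disjoint_left]
    intro x hx hx'
    exact absurd hx.2 (not_lt.2 hx')

lemma ton_gen (m : Measure ℝ) [SFinite m] (R : Set (ℝ × ℝ)) (hR : MeasurableSet R)
    (w h : ℝ → ℝ≥0∞) (hw : Measurable w) (hh : Measurable h) :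
    ∫⁻ u, w u * (∫⁻ s in {s | (u, s) ∈ R}, h s) ∂m =
      ∫⁻ s, h s * (∫⁻ u in {u | (u, s) ∈ R}, w u ∂m) := by
  have e1 : ∀ u, w u * (∫⁻ s in {s | (u, s) ∈ R}, h s) =
      ∫⁻ s, R.indicator (fun q => w q.1 * h q.2) (u, s) := by
    intro u
    rw [← lintegral_const_mul _ hh, ← lintegral_indicator (s := {s | (u, s) ∈ R})
      (measurable_prodMk_left hR)]
    rfl
  have e2 : ∀ s, h s * (∫⁻ u in {u | (u, s) ∈ R}, w u ∂m) =
      ∫⁻ u, R.indicator (fun q => w q.1 * h q.2) (u, s) ∂m := by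
    intro s
    rw [← lintegral_const_mul _ hw, ← lintegral_indicator (s := {u | (u, s) ∈ R})
      (measurable_prodMk_right hR)]
    apply lintegral_congr
    intro u
    simp only [indicator, mem_ofPred_eq, mul_comm]
  simp_rw [e1, e2]
  apply lintegral_lintegral_swap
  apply Measurable.aemeasurable
  apply Measurable.indicator _ hR
  fun_prop

lemma ton_left (m : Measure ℝ) [SFinite m] (t : ℝ)
    (h : ℝ → ℝ≥0∞) (hh : Measurable h) :
    ∫⁻ u in Ioo 0 t, (∫⁻ s in Ioo u t, h s) ∂m = ∫⁻ s in Ioo 0 t, h s * m (Ioo 0 s) := by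
  have hR : MeasurableSet {q : ℝ × ℝ | (0 < q.1 ∧ q.1 < q.2) ∧ q.2 < t} := by
    apply MeasurableSet.inter
    · apply MeasurableSet.inter
      · exact measurableSet_lt measurable_const measurable_fst
      · exact measurableSet_lt measurable_fst measurable_snd
    · exact measurableSet_lt measurable_snd measurable_const
  have := ton_gen m _ hR (fun _ => 1) h measurable_const hh
  simp only [one_mul, lintegral_one, Measure.restrict_apply_univ] at this
  rw [← lintegral_indicator measurableSet_Ioo, ← lintegral_indicator measurableSet_Ioo]
  convert this using 2
  · ext u
    by_cases hu : u ∈ Ioo 0 t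
    · rw [indicator_of_mem hu]
      congr 2
      ext s
      simp only [mem_Ioo, mem_ofPred_eq]
      have := hu.1
      tauto
    · rw [indicator_of_notMem hu]
      have : {s | (u, s) ∈ {q : ℝ × ℝ | (0 < q.1 ∧ q.1 < q.2) ∧ q.2 < t}} = ∅ := by
        ext s
        simp only [mem_ofPred_eq, mem_empty_iff_false, iff_false]
        rintro ⟨⟨h1, h2⟩, h3⟩
        exact hu ⟨h1, h2.trans h3⟩
      rw [this]; simp
  · ext s
    by_cases hs : s ∈ Ioo 0 t
    · rw [indicator_of_mem hs]
      congr 2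
      ext u
      simp only [mem_Ioo, mem_ofPred_eq]
      have := hs.2
      tauto
    · rw [indicator_of_notMem hs]
      have : {u | (u, s) ∈ {q : ℝ × ℝ | (0 < q.1 ∧ q.1 < q.2) ∧ q.2 < t}} = ∅ := by
        ext u
        simp only [mem_ofPred_eq, mem_empty_iff_false, iff_false]
        rintro ⟨⟨h1, h2⟩, h3⟩
        exact hs ⟨h1.trans h2, h3⟩
      rw [this]; simp

lemma ton_right (m : Measure ℝ) [SFinite m] (t : ℝ)
    (w h : ℝ → ℝ≥0∞) (hw : Measurable w) (hh : Measurable h) :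
    ∫⁻ u in Ioi t, w u * (∫⁻ s in Ioo t u, h s) ∂m =
      ∫⁻ s in Ioi t, h s * (∫⁻ u in Ioi s, w u ∂m) := by
  have hR : MeasurableSet {q : ℝ × ℝ | t < q.2 ∧ q.2 < q.1} := by
    apply MeasurableSet.inter
    · exact measurableSet_lt measurable_const measurable_snd
    · exact measurableSet_lt measurable_snd measurable_fst
  have := ton_gen m _ hR w h hw hh
  rw [← lintegral_indicator measurableSet_Ioi, ← lintegral_indicator measurableSet_Ioi]
  convert this using 2
  · ext u
    by_cases hu : u ∈ Ioi t
    · rw [indicator_of_mem hu]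
      rfl
    · rw [indicator_of_notMem hu]
      have : {s | (u, s) ∈ {q : ℝ × ℝ | t < q.2 ∧ q.2 < q.1}} = ∅ := by
        ext s
        simp only [mem_ofPred_eq, mem_empty_iff_false, iff_false]
        rintro ⟨h1, h2⟩
        exact hu (h1.trans h2)
      rw [this]; simp
  · ext s
    by_cases hs : s ∈ Ioi t
    · rw [indicator_of_mem hs]
      congr 3
      ext u
      simp only [mem_Ioi, mem_ofPred_eq]
      have : t < s := hs
      tauto
    · rw [indicator_of_notMem hs]
      have : {u | (u, s) ∈ {q : ℝ × ℝ | t < q.2 ∧ q.2 < q.1}} = ∅ := by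
        ext u
        simp only [mem_ofPred_eq, mem_empty_iff_false, iff_false]
        rintro ⟨h1, h2⟩
        exact hs h1
      rw [this]; simp

/-- constant multiple bound -/
lemma setL_le_const {S : Set ℝ} (hS : MeasurableSet S) (c b : ℝ) (hc : 0 ≤ c) (f k : ℝ → ℝ)
    (h : ∀ s ∈ S, f s ≤ c * k s)
    (hk : ∫⁻ s in S, ENNReal.ofReal (k s) ≤ ENNReal.ofReal b) :
    ∫⁻ s in S, ENNReal.ofReal (f s) ≤ ENNReal.ofReal (c * b) := by
  calc ∫⁻ s in S, ENNReal.ofReal (f s) ≤ ∫⁻ s in S, ENNReal.ofReal c * ENNReal.ofReal (k s) := by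
        apply setLIntegral_mono' hS
        intro s hs
        rw [← ENNReal.ofReal_mul hc]
        exact ENNReal.ofReal_le_ofReal (h s hs)
    _ = ENNReal.ofReal c * ∫⁻ s in S, ENNReal.ofReal (k s) :=
        lintegral_const_mul' _ _ ENNReal.ofReal_ne_top
    _ ≤ _ := by
        rw [ENNReal.ofReal_mul hc]
        gcongr

lemma setL_ge_const {S : Set ℝ} (hS : MeasurableSet S) (c b : ℝ) (hc : 0 ≤ c) (f k : ℝ → ℝ)
    (h : ∀ s ∈ S, c * k s ≤ f s)
    (hk : ENNReal.ofReal b ≤ ∫⁻ s in S, ENNReal.ofReal (k s)) :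
    ENNReal.ofReal (c * b) ≤ ∫⁻ s in S, ENNReal.ofReal (f s) := by
  calc ENNReal.ofReal (c * b) ≤ ENNReal.ofReal c * ∫⁻ s in S, ENNReal.ofReal (k s) := by
        rw [ENNReal.ofReal_mul hc]
        gcongr
    _ = ∫⁻ s in S, ENNReal.ofReal c * ENNReal.ofReal (k s) :=
        (lintegral_const_mul' _ _ ENNReal.ofReal_ne_top).symm
    _ ≤ _ := by
        apply setLIntegral_mono' hS
        intro s hs
        rw [← ENNReal.ofReal_mul hc]
        exact ENNReal.ofReal_le_ofReal (h s hs)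

namespace Setup
variable {p : ℝ} {m : Measure ℝ} {A B Z : ℝ → ℝ}

lemma DEpow (S : Setup p m A B Z) (r : ℝ) {s : ℝ} (hs : 0 < s) :
    Df p A B s ^ r = s ^ (p * r) * Ef p A B s ^ r := by
  rw [DE s hs, Real.mul_rpow (by positivity) (S.Epos hs).le, Real.rpow_mul hs.le]

lemma DEinv (S : Setup p m A B Z) {s : ℝ} (hs : 0 < s) :
    Df p A B s ^ (-(1/p)) = s⁻¹ * Ef p A B s ^ (-(1/p)) := by
  have := S.p0
  rw [S.DEpow _ hs, show p * -(1/p) = -1 by field_simp, Real.rpow_neg_one]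

lemma S1 (S : Setup p m A B Z) {t : ℝ} (ht : 0 < t) :
    ∫⁻ s in Ioi 0, ENNReal.ofReal (s / (s + t) * Df p A B s ^ (-(1/p)) * zf p A B s) ≤
      ENNReal.ofReal (2 * Df p A B t ^ (-(1/p))) := by
  have hp := S.p0
  have hDt := S.Dpos ht
  have hEt := S.Epos ht
  rw [split_at _ _ ht, two_mul, ENNReal.ofReal_add (by positivity) (by positivity)]
  apply add_le_add
  · refine (setL_le_const measurableSet_Ioo (t⁻¹ * (1/p)) _ (by positivity) _
      (fun s => Ef p A B s ^ (-(1/p) - 1) * ee p A s) ?_ (S.L1_le (by positivity) ht)).trans ?_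
    · intro s hs
      have hs0 : 0 < s := hs.1
      have hE := S.Epos hs0
      have he := S.epos hs0
      have hz := S.zpos hs0
      rw [S.DEinv hs0, Real.rpow_sub_one hE.ne']
      calc s / (s + t) * (s⁻¹ * Ef p A B s ^ (-(1/p))) * zf p A B s
          ≤ s / t * (s⁻¹ * Ef p A B s ^ (-(1/p))) * (ee p A s / (p * Ef p A B s)) := by
            gcongr
            · linarith
            · exact S.zb2 hs0
        _ = _ := by field_simp
    · apply ENNReal.ofReal_le_ofReal
      rw [S.DEinv ht]
      apply le_of_eq; field_simp
  · refine (setL_le_const measurableSet_Ioi (1/p) _ (by positivity) _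
      (fun s => Df p A B s ^ (-(1/p) - 1) * dd p B s) ?_ (S.R1_le (by positivity) ht)).trans ?_
    · intro s hs
      have hs0 : 0 < s := ht.trans hs
      have hD := S.Dpos hs0
      have he := S.dpos hs0
      have hz := S.zpos hs0
      rw [Real.rpow_sub_one hD.ne']
      calc s / (s + t) * Df p A B s ^ (-(1/p)) * zf p A B s
          ≤ 1 * Df p A B s ^ (-(1/p)) * (dd p B s / (p * Df p A B s)) := by
            gcongr
            · rw [div_le_one (by positivity)]; linarith
            · exact S.zb1 hs0
        _ = _ := by field_simp
    · apply ENNReal.ofReal_le_ofReal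
      apply le_of_eq; field_simp

lemma expD (S : Setup p m A B Z) {s t η : ℝ} (hη : 0 < η) (hs : 0 < s) (hst : s ≤ t) :
    Df p A B s ^ (η / p) * Df p A B t ^ (-(η / p)) ≤ Real.exp (-(η * |Z t - Z s|)) := by
  have hp := S.p0
  have h1 := S.ZlogD hs hst
  have h2 := S.Zmono hs hst
  rw [Real.rpow_def_of_pos (S.Dpos hs), Real.rpow_def_of_pos (S.Dpos (hs.trans_le hst)),
    ← Real.exp_add, abs_of_nonneg (by linarith)]
  apply Real.exp_le_exp.2
  have := mul_le_mul_of_nonneg_left h1 hη.le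
  have e : η * ((Real.log (Df p A B t) - Real.log (Df p A B s)) / p) =
    -(Real.log (Df p A B s) * (η / p) + Real.log (Df p A B t) * -(η / p)) := by ring
  linarith

lemma expE (S : Setup p m A B Z) {s t η : ℝ} (hη : 0 < η) (hs : 0 < s) (hst : s ≤ t) :
    Ef p A B t ^ (η / p) * Ef p A B s ^ (-(η / p)) ≤ Real.exp (-(η * |Z s - Z t|)) := by
  have hp := S.p0
  have h1 := S.ZlogE hs hst
  have h2 := S.Zmono hs hst
  rw [Real.rpow_def_of_pos (S.Epos hs), Real.rpow_def_of_pos (S.Epos (hs.trans_le hst)),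
    ← Real.exp_add, abs_of_nonpos (by linarith)]
  apply Real.exp_le_exp.2
  have := mul_le_mul_of_nonneg_left h1 hη.le
  have e : η * ((Real.log (Ef p A B s) - Real.log (Ef p A B t)) / p) =
    -(Real.log (Ef p A B t) * (η / p) + Real.log (Ef p A B s) * -(η / p)) := by ring
  linarith

lemma K_ge (S : Setup p m A B Z) {η t : ℝ} (hη : 0 < η) (ht : 0 < t) :
    ENNReal.ofReal ((1 / (2 * (1 + p + η))) * Df p A B t ^ (-(1/p))) ≤
    ∫⁻ s in Ioi 0, ENNReal.ofReal (s / (s + t) * Df p A B s ^ (-(1/p)) *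
      Real.exp (-(η * |Z s - Z t|)) * zf p A B s) := by
  have hp := S.p0
  have hDt := S.Dpos ht
  have hEt := S.Epos ht
  have hAt := S.Apos t ht
  have hBt := S.Bpos t ht
  have hr : 0 < 1 / p + 1 + η / p := by positivity
  rw [split_at _ _ ht]
  have hL : ENNReal.ofReal ((1 / (2 * (1 + p + η))) * Df p A B t ^ (-(1/p)) *
      (B t / Ef p A B t)) ≤ ∫⁻ s in Ioo 0 t, ENNReal.ofReal (s / (s + t) * Df p A B s ^ (-(1/p)) *
      Real.exp (-(η * |Z s - Z t|)) * zf p A B s) := by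
    refine le_trans ?_ (setL_ge_const measurableSet_Ioo
      (1 / (2 * t) * Ef p A B t ^ (η / p) * (B t / p)) _ (by positivity) _
      (fun s => Ef p A B s ^ (-(1 / p + 1 + η / p) - 1) * ee p A s) ?_ (S.L1_ge hr ht))
    · apply ENNReal.ofReal_le_ofReal
      rw [S.DEinv ht, show -(1 / p + 1 + η / p) = -(1/p) - 1 - η/p by ring,
        Real.rpow_sub hEt, Real.rpow_sub_one hEt.ne']
      have : 0 < Ef p A B t ^ (η / p) := by positivity
      apply le_of_eq
      field_simp
    · intro s hs
      have hs0 : 0 < s := hs.1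
      have hE := S.Epos hs0
      have he := S.epos hs0
      have hz := S.zpos hs0
      have hx := S.expE hη hs0 hs.2.le
      rw [S.DEinv hs0, S.zE hs0]
      calc 1 / (2 * t) * Ef p A B t ^ (η / p) * (B t / p) *
            (Ef p A B s ^ (-(1 / p + 1 + η / p) - 1) * ee p A s)
          = s / (t + t) * (s⁻¹ * Ef p A B s ^ (-(1/p))) *
            (Ef p A B t ^ (η / p) * Ef p A B s ^ (-(η / p))) *
            (B t * ee p A s / (p * Ef p A B s ^ 2)) := by
              rw [show -(1 / p + 1 + η / p) - 1 = -(1/p) + -(η/p) - 1 - 1 by ring,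
                Real.rpow_sub_one hE.ne', Real.rpow_sub_one hE.ne', Real.rpow_add hE]
              field_simp
              try norm_num
        _ ≤ _ := by
          gcongr
          · exact hs.2.le
          · exact S.Banti s t hs0 hs.2.le
  have hR : ENNReal.ofReal ((1 / (2 * (1 + p + η))) * Df p A B t ^ (-(1/p)) *
      (A t / Df p A B t)) ≤ ∫⁻ s in Ioi t, ENNReal.ofReal (s / (s + t) * Df p A B s ^ (-(1/p)) *
      Real.exp (-(η * |Z s - Z t|)) * zf p A B s) := by
    refine le_trans ?_ (setL_ge_const measurableSet_Ioi
      (1 / 2 * Df p A B t ^ (η / p) * (A t / p)) _ (by positivity) _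
      (fun s => Df p A B s ^ (-(1 / p + 1 + η / p) - 1) * dd p B s) ?_ (S.R1_ge hr ht))
    · apply ENNReal.ofReal_le_ofReal
      rw [show -(1 / p + 1 + η / p) = -(1/p) - 1 - η/p by ring,
        Real.rpow_sub hDt, Real.rpow_sub_one hDt.ne']
      have : 0 < Df p A B t ^ (η / p) := by positivity
      apply le_of_eq
      field_simp
    · intro s hs
      have hts : t < s := hs
      have hs0 : 0 < s := ht.trans hs
      have hD := S.Dpos hs0
      have he := S.dpos hs0
      have hz := S.zpos hs0
      have hx := S.expD hη ht hts.le
      rw [S.zD hs0]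
      calc 1 / 2 * Df p A B t ^ (η / p) * (A t / p) *
            (Df p A B s ^ (-(1 / p + 1 + η / p) - 1) * dd p B s)
          = s / (s + s) * (Df p A B s ^ (-(1/p))) *
            (Df p A B t ^ (η / p) * Df p A B s ^ (-(η / p))) *
            (A t * dd p B s / (p * Df p A B s ^ 2)) := by
              rw [show -(1 / p + 1 + η / p) - 1 = -(1/p) + -(η/p) - 1 - 1 by ring,
                Real.rpow_sub_one hD.ne', Real.rpow_sub_one hD.ne', Real.rpow_add hD]
              field_simp
              try norm_num
        _ ≤ _ := by
          gcongr
          · exact S.Amono t s ht hts.le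
  refine le_trans ?_ (add_le_add hL hR)
  rw [← ENNReal.ofReal_add (by positivity) (by positivity), ← mul_add]
  apply ENNReal.ofReal_le_ofReal
  have e : B t / Ef p A B t + A t / Df p A B t = 1 := by
    have e1 : B t / Ef p A B t = t ^ p * B t / Df p A B t := by
      rw [DE t ht]; field_simp
    rw [e1, ← add_div, div_eq_one_iff_eq hDt.ne']
    unfold Df; ring
  rw [e, mul_one]

end Setup

namespace Setup
variable {p : ℝ} {m : Measure ℝ} {A B Z : ℝ → ℝ}

lemma Zcont (S : Setup p m A B Z) : ContinuousOn Z (Ioi 0) :=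
  fun x hx => (S.hZ x hx).continuousAt.continuousWithinAt

lemma expInt (S : Setup p m A B Z) {ε u : ℝ} (hε : 0 < ε) (hu : 0 < u) :
    ∫⁻ s in Ioi 0, ENNReal.ofReal (Real.exp (-(ε * |Z s - Z u|)) * zf p A B s) ≤
      ENNReal.ofReal (2 / ε) := by
  have hd1 : ∀ s, 0 < s → HasDerivAt (fun s => Real.exp (ε * (Z s - Z u)) / ε)
      (Real.exp (ε * (Z s - Z u)) * zf p A B s) s := by
    intro s hs
    refine ((((S.hZ s hs).sub_const (Z u)).const_mul ε).exp.div_const ε).congr_deriv ?_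
    field_simp
  have hd2 : ∀ s, 0 < s → HasDerivAt (fun s => -(Real.exp (-(ε * (Z s - Z u))) / ε))
      (Real.exp (-(ε * (Z s - Z u))) * zf p A B s) s := by
    intro s hs
    refine ((((S.hZ s hs).sub_const (Z u)).const_mul ε).neg.exp.div_const ε).neg.congr_deriv ?_
    simp only [Pi.neg_apply]
    field_simp
  have hc := S.Zcont
  have hzc := S.zcont
  have h1 := ftc_left_le _ _ hd1 (by fun_prop)
    (fun s hs => by have := S.zpos hs; positivity) (fun s hs => by positivity) hu
  have h2 := ftc_right_le _ _ hd2 (by fun_prop)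
    (fun s hs => by have := S.zpos hs; positivity)
    (fun s hs => by simp only [Left.neg_nonpos_iff]; positivity) hu
  rw [split_at _ _ hu, show (2:ℝ) / ε = 1 / ε + 1 / ε by ring,
    ENNReal.ofReal_add (by positivity) (by positivity)]
  apply add_le_add
  · refine le_trans (le_of_eq (setLIntegral_congr_fun measurableSet_Ioo ?_)) (h1.trans ?_)
    · intro s hs
      have := S.Zmono hs.1 hs.2.le
      simp only
      rw [abs_of_nonpos (by linarith)]
      ring_nf
    · simp
  · refine le_trans (le_of_eq (setLIntegral_congr_fun measurableSet_Ioi ?_)) (h2.trans ?_)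
    · intro s hs
      have := S.Zmono hu (le_of_lt hs)
      simp only
      rw [abs_of_nonneg (by linarith)]
    · simp

lemma S2_left [SFinite m] (S : Setup p m A B Z) {q s : ℝ} (hq : 0 < q) (hq1 : q < 1) (hs : 0 < s) :
    ∫⁻ t in Ioo 0 s, ENNReal.ofReal (Df p A B t ^ (-q)) ∂m ≤
      ENNReal.ofReal (1 / (1 - q) * Df p A B s ^ (1 - q)) := by
  have hDs := S.Dpos hs
  have hq2 : 0 < 1 - q := by linarith
  have hmd : Measurable (fun x => ENNReal.ofReal (Df p A B x ^ (-q - 1) * dd p B x)) := by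
    have := S.mD; have := S.mB
    unfold dd
    fun_prop
  have e1 : ∀ t ∈ Ioo 0 s, ENNReal.ofReal (Df p A B t ^ (-q)) = ENNReal.ofReal (Df p A B s ^ (-q)) +
      ENNReal.ofReal q * ∫⁻ x in Ioo t s, ENNReal.ofReal (Df p A B x ^ (-q - 1) * dd p B x) := by
    intro t ht
    have hmono : Df p A B s ^ (-q) ≤ Df p A B t ^ (-q) := by
      have h := S.ZlogD ht.1 ht.2.le
      have h' := S.Zmono ht.1 ht.2.le
      have h3 : 0 ≤ (Real.log (Df p A B s) - Real.log (Df p A B t)) / p := by linarith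
      have h4 : Real.log (Df p A B t) ≤ Real.log (Df p A B s) := by
        have := mul_nonneg h3 S.p0.le
        rw [div_mul_cancel₀ _ S.p0.ne'] at this
        linarith
      rw [Real.log_le_log_iff (S.Dpos ht.1) hDs] at h4
      exact Real.rpow_le_rpow_of_nonpos (S.Dpos ht.1) h4 (by linarith)
    have hDt := S.Dpos ht.1
    rw [ftc_Ioo _ _ (S.derD (neg_ne_zero.2 hq.ne')) (S.derDc _) (S.derD0 _) ht.1 ht.2.le,
      ← ENNReal.ofReal_mul hq.le, ← ENNReal.ofReal_add (by positivity)]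
    · congr 1
      field_simp; ring
    · rw [mul_sub]; field_simp; linarith
  rw [setLIntegral_congr_fun measurableSet_Ioo e1, lintegral_add_left measurable_const,
    lintegral_const_mul' _ _ ENNReal.ofReal_ne_top, ton_left m s _ hmd, lintegral_const,
    Measure.restrict_apply_univ, S.hA s hs]
  have h2 := setL_le_const measurableSet_Ioo 1 (Df p A B s ^ (1 - q) / (1 - q)) zero_le_one
    (fun x => Df p A B x ^ (-q - 1) * dd p B x * A x)
    (fun x => Df p A B x ^ ((1 - q) - 1) * dd p B x) (by
      intro x hx
      have hD := S.Dpos hx.1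
      have hd := S.dpos hx.1
      have e : Df p A B x ^ ((1 - q) - 1) = Df p A B x ^ (-q - 1) * Df p A B x := by
        rw [← Real.rpow_add_one hD.ne']; congr 1; ring
      rw [e]
      have : Df p A B x ^ (-q - 1) * dd p B x * A x ≤
        Df p A B x ^ (-q - 1) * dd p B x * Df p A B x :=
        mul_le_mul_of_nonneg_left (S.AleD hx.1) (by positivity)
      linarith) (S.R2_le hq2 hs)
  have e3 : ∫⁻ x in Ioo 0 s, ENNReal.ofReal (Df p A B x ^ (-q - 1) * dd p B x) * m (Ioo 0 x) =
      ∫⁻ x in Ioo 0 s, ENNReal.ofReal (Df p A B x ^ (-q - 1) * dd p B x * A x) := by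
    apply setLIntegral_congr_fun measurableSet_Ioo
    intro x hx
    simp only
    rw [S.hA x hx.1, ← ENNReal.ofReal_mul (S.derD0 _ x hx.1)]
  rw [e3]
  calc _ ≤ ENNReal.ofReal (Df p A B s ^ (-q)) * ENNReal.ofReal (Df p A B s) +
        ENNReal.ofReal q * ENNReal.ofReal (1 * (Df p A B s ^ (1 - q) / (1 - q))) := by
        gcongr
        exact S.AleD hs
    _ = _ := by
      rw [← ENNReal.ofReal_mul (by positivity), ← ENNReal.ofReal_mul (by positivity),
        ← ENNReal.ofReal_add (by positivity) (by positivity), ← Real.rpow_add_one hDs.ne',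
        show -q + 1 = 1 - q by ring]
      congr 1
      field_simp; ring

lemma S2_right [SFinite m] (S : Setup p m A B Z) {q s : ℝ} (hq : 0 < q) (hq1 : q < 1) (hs : 0 < s) :
    ∫⁻ t in Ioi s, ENNReal.ofReal (t ^ (-p)) * ENNReal.ofReal (Ef p A B t ^ (-q)) ∂m ≤
      ENNReal.ofReal (1 / (1 - q) * Ef p A B s ^ (1 - q)) := by
  have hDs := S.Epos hs
  have hq2 : 0 < 1 - q := by linarith
  have hmd : Measurable (fun x => ENNReal.ofReal (Ef p A B x ^ (-q - 1) * ee p A x)) := by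
    have := S.mA; have := S.mB
    unfold ee Ef
    fun_prop
  have hmw : Measurable (fun t : ℝ => ENNReal.ofReal (t ^ (-p))) := by fun_prop
  have e1 : ∀ t ∈ Ioi s, ENNReal.ofReal (t ^ (-p)) * ENNReal.ofReal (Ef p A B t ^ (-q)) =
      ENNReal.ofReal (t ^ (-p)) * ENNReal.ofReal (Ef p A B s ^ (-q)) +
      ENNReal.ofReal q * (ENNReal.ofReal (t ^ (-p)) *
        ∫⁻ x in Ioo s t, ENNReal.ofReal (Ef p A B x ^ (-q - 1) * ee p A x)) := by
    intro t ht'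
    have ht : s < t := ht'
    have ht0 := hs.trans ht
    have hmono : Ef p A B s ^ (-q) ≤ Ef p A B t ^ (-q) := by
      have h := S.ZlogE hs ht.le
      have h' := S.Zmono hs ht.le
      have h3 : 0 ≤ (Real.log (Ef p A B s) - Real.log (Ef p A B t)) / p := by linarith
      have h4 : Real.log (Ef p A B t) ≤ Real.log (Ef p A B s) := by
        have := mul_nonneg h3 S.p0.le
        rw [div_mul_cancel₀ _ S.p0.ne'] at this
        linarith
      rw [Real.log_le_log_iff (S.Epos ht0) hDs] at h4
      exact Real.rpow_le_rpow_of_nonpos (S.Epos ht0) h4 (by linarith)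
    have hDt := S.Epos ht0
    rw [ftc_Ioo _ _ (S.derE (neg_ne_zero.2 hq.ne')) (S.derEc _) (S.derE0 _) hs ht.le,
      mul_left_comm, ← mul_add,
      ← ENNReal.ofReal_mul hq.le, ← ENNReal.ofReal_add (by positivity)]
    · congr 2
      field_simp; ring
    · rw [mul_sub]; field_simp; linarith
  rw [setLIntegral_congr_fun measurableSet_Ioi e1, lintegral_add_left (by fun_prop),
    lintegral_const_mul' _ _ ENNReal.ofReal_ne_top, ton_right m s _ _ hmw hmd,
    lintegral_mul_const _ hmw, S.hB s hs]
  have h2 := setL_le_const measurableSet_Ioi 1 (Ef p A B s ^ (1 - q) / (1 - q)) zero_le_one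
    (fun x => Ef p A B x ^ (-q - 1) * ee p A x * B x)
    (fun x => Ef p A B x ^ ((1 - q) - 1) * ee p A x) (by
      intro x hx'
      have hx : 0 < x := hs.trans hx'
      have hD := S.Epos hx
      have hd := S.epos hx
      have e : Ef p A B x ^ ((1 - q) - 1) = Ef p A B x ^ (-q - 1) * Ef p A B x := by
        rw [← Real.rpow_add_one hD.ne']; congr 1; ring
      rw [e]
      have : Ef p A B x ^ (-q - 1) * ee p A x * B x ≤
        Ef p A B x ^ (-q - 1) * ee p A x * Ef p A B x :=
        mul_le_mul_of_nonneg_left (S.BleE hx) (by positivity)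
      linarith) (S.L2_le hq2 hs)
  have e3 : ∫⁻ x in Ioi s, ENNReal.ofReal (Ef p A B x ^ (-q - 1) * ee p A x) *
        (∫⁻ u in Ioi x, ENNReal.ofReal (u ^ (-p)) ∂m) =
      ∫⁻ x in Ioi s, ENNReal.ofReal (Ef p A B x ^ (-q - 1) * ee p A x * B x) := by
    apply setLIntegral_congr_fun measurableSet_Ioi
    intro x hx
    have hx0 : 0 < x := hs.trans hx
    simp only
    rw [S.hB x hx0, ← ENNReal.ofReal_mul (S.derE0 _ x hx0)]
  rw [e3]
  calc _ ≤ ENNReal.ofReal (Ef p A B s) * ENNReal.ofReal (Ef p A B s ^ (-q)) +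
        ENNReal.ofReal q * ENNReal.ofReal (1 * (Ef p A B s ^ (1 - q) / (1 - q))) := by
        gcongr
        exact S.BleE hs
    _ = _ := by
      rw [mul_comm, ← ENNReal.ofReal_mul (by positivity), ← ENNReal.ofReal_mul (by positivity),
        ← ENNReal.ofReal_add (by positivity) (by positivity), ← Real.rpow_add_one hDs.ne',
        show -q + 1 = 1 - q by ring]
      congr 1
      field_simp; ring

lemma S2 [SFinite m] [NullSingletonClass m] (S : Setup p m A B Z) {s : ℝ} (hs : 0 < s) :
    ∫⁻ t in Ioi 0, ENNReal.ofReal (s / (s + t) * Df p A B t ^ (-(1 - 1 / p))) ∂m ≤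
      ENNReal.ofReal (2 * p * Df p A B s ^ (1 / p)) := by
  have hp := S.p0
  have hp1 := S.hp
  have hq : 0 < 1 - 1 / p := by
    rw [sub_pos, div_lt_one hp]; exact hp1
  have hq1 : 1 - 1 / p < 1 := by
    have : 0 < 1 / p := by positivity
    linarith
  have hDs := S.Dpos hs
  have hEs := S.Epos hs
  have h1 := S.S2_left hq hq1 hs
  have h2 := S.S2_right hq hq1 hs
  rw [split_at _ _ hs, show 2 * p * Df p A B s ^ (1 / p) =
    p * Df p A B s ^ (1 / p) + p * Df p A B s ^ (1 / p) by ring,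
    ENNReal.ofReal_add (by positivity) (by positivity)]
  apply add_le_add
  · calc _ ≤ ∫⁻ t in Ioo 0 s, ENNReal.ofReal (Df p A B t ^ (-(1 - 1 / p))) ∂m := by
          apply setLIntegral_mono' measurableSet_Ioo
          intro t ht
          apply ENNReal.ofReal_le_ofReal
          have := S.Dpos ht.1
          have ht0 := ht.1
          apply mul_le_of_le_one_left (by positivity)
          rw [div_le_one (by positivity)]; linarith
      _ ≤ _ := h1
      _ = _ := by
        rw [show 1 - (1 - 1 / p) = 1 / p by ring]; simp
  · calc _ ≤ ∫⁻ t in Ioi s, ENNReal.ofReal s * (ENNReal.ofReal (t ^ (-p)) *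
            ENNReal.ofReal (Ef p A B t ^ (-(1 - 1 / p)))) ∂m := by
          apply setLIntegral_mono' measurableSet_Ioi
          intro t ht
          have ht0 : 0 < t := hs.trans ht
          have hE := S.Epos ht0
          rw [← ENNReal.ofReal_mul (by positivity), ← ENNReal.ofReal_mul (by positivity)]
          apply ENNReal.ofReal_le_ofReal
          rw [S.DEpow _ ht0]
          have e : t ^ (-p) = t⁻¹ * t ^ (p * -(1 - 1 / p)) := by
            rw [← Real.rpow_neg_one t, ← Real.rpow_add ht0]
            congr 1
            field_simp; ring
          rw [e]
          have : s / (s + t) ≤ s * t⁻¹ := by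
            rw [← div_eq_mul_inv]
            gcongr
            linarith
          calc _ ≤ s * t⁻¹ * (t ^ (p * -(1 - 1 / p)) * Ef p A B t ^ (-(1 - 1 / p))) := by
                gcongr
            _ = _ := by ring
      _ = ENNReal.ofReal s * _ := lintegral_const_mul' _ _ ENNReal.ofReal_ne_top
      _ ≤ ENNReal.ofReal s * _ := mul_le_mul' le_rfl h2
      _ = _ := by
        rw [← ENNReal.ofReal_mul hs.le, S.DEpow _ hs]
        congr 1
        rw [show 1 - (1 - 1 / p) = 1 / p by ring, mul_one_div_cancel hp.ne', Real.rpow_one,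
          one_div_one_div]
        ring

/-- lower bound for the smoothed mass -/
lemma G_left [SFinite m] (S : Setup p m A B Z) {t : ℝ} (ht : 0 < t) :
    ∫⁻ u in Ioo 0 t, ENNReal.ofReal (Z t - Z u) ∂m ≤ ENNReal.ofReal (Df p A B t / p) := by
  have hp := S.p0
  have e1 : ∀ u ∈ Ioo 0 t, ENNReal.ofReal (Z t - Z u) =
      ∫⁻ s in Ioo u t, ENNReal.ofReal (zf p A B s) := by
    intro u hu
    rw [ftc_Ioo Z _ S.hZ S.zcont (fun s hs => (S.zpos hs).le) hu.1 hu.2.le]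
  have hmz := S.mz
  rw [setLIntegral_congr_fun measurableSet_Ioo e1, ton_left m t _ (by fun_prop)]
  have e3 : ∫⁻ x in Ioo 0 t, ENNReal.ofReal (zf p A B x) * m (Ioo 0 x) =
      ∫⁻ x in Ioo 0 t, ENNReal.ofReal (zf p A B x * A x) := by
    apply setLIntegral_congr_fun measurableSet_Ioo
    intro x hx
    simp only
    rw [S.hA x hx.1, ← ENNReal.ofReal_mul (S.zpos hx.1).le]
  rw [e3]
  refine (setL_le_const measurableSet_Ioo (1/p) _ (by positivity) _
      (fun s => Df p A B s ^ ((1:ℝ) - 1) * dd p B s) ?_ (S.R2_le zero_lt_one ht)).trans ?_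
  · intro s hs
    have := S.Az hs.1
    simp only [sub_self, Real.rpow_zero, one_mul]
    rw [one_div_mul_eq_div]; exact this
  · apply le_of_eq
    simp; ring_nf

lemma G_right [SFinite m] (S : Setup p m A B Z) {t : ℝ} (ht : 0 < t) :
    ∫⁻ u in Ioi t, ENNReal.ofReal (u ^ (-p)) * ENNReal.ofReal (Z u - Z t) ∂m ≤
      ENNReal.ofReal (Ef p A B t / p) := by
  have hp := S.p0
  have e1 : ∀ u ∈ Ioi t, ENNReal.ofReal (u ^ (-p)) * ENNReal.ofReal (Z u - Z t) =
      ENNReal.ofReal (u ^ (-p)) * ∫⁻ s in Ioo t u, ENNReal.ofReal (zf p A B s) := by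
    intro u hu
    rw [ftc_Ioo Z _ S.hZ S.zcont (fun s hs => (S.zpos hs).le) ht (le_of_lt hu)]
  have hmz := S.mz
  rw [setLIntegral_congr_fun measurableSet_Ioi e1, ton_right m t _ _ (by fun_prop) (by fun_prop)]
  have e3 : ∫⁻ x in Ioi t, ENNReal.ofReal (zf p A B x) *
        (∫⁻ u in Ioi x, ENNReal.ofReal (u ^ (-p)) ∂m) =
      ∫⁻ x in Ioi t, ENNReal.ofReal (zf p A B x * B x) := by
    apply setLIntegral_congr_fun measurableSet_Ioi
    intro x hx
    have hx0 : 0 < x := ht.trans hx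
    simp only
    rw [S.hB x hx0, ← ENNReal.ofReal_mul (S.zpos hx0).le]
  rw [e3]
  refine (setL_le_const measurableSet_Ioi (1/p) _ (by positivity) _
      (fun s => Ef p A B s ^ ((1:ℝ) - 1) * ee p A s) ?_ (S.L2_le zero_lt_one ht)).trans ?_
  · intro s hs
    have := S.Bz (ht.trans hs)
    simp only [sub_self, Real.rpow_zero, one_mul]
    rw [one_div_mul_eq_div]; exact this
  · apply le_of_eq
    simp; ring_nf

lemma exp_help (ε x : ℝ) (hε : 0 ≤ ε) :
    1 ≤ ENNReal.ofReal (Real.exp (-(ε * |x|))) + ENNReal.ofReal (ε * |x|) := by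
  rw [← ENNReal.ofReal_add (by positivity) (by positivity)]
  rw [ENNReal.one_le_ofReal]
  have := Real.add_one_le_exp (-(ε * |x|))
  linarith

lemma G_ge [SFinite m] [NullSingletonClass m] (S : Setup p m A B Z) {t : ℝ} (ht : 0 < t) :
    ENNReal.ofReal (Df p A B t / 2) ≤
    ∫⁻ u in Ioi 0, ENNReal.ofReal (min 1 (t ^ p * u ^ (-p))) *
      ENNReal.ofReal (Real.exp (-(p / 4 * |Z u - Z t|))) ∂m := by
  have hp := S.p0
  have hDt := S.Dpos ht
  have hAt := S.Apos t ht
  have hBt := S.Bpos t ht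
  have hmZ := S.mZ
  rw [split_at _ _ ht]
  set X := ∫⁻ u in Ioo 0 t, ENNReal.ofReal (min 1 (t ^ p * u ^ (-p))) *
      ENNReal.ofReal (Real.exp (-(p / 4 * |Z u - Z t|))) ∂m with hX
  set Y := ∫⁻ u in Ioi t, ENNReal.ofReal (min 1 (t ^ p * u ^ (-p))) *
      ENNReal.ofReal (Real.exp (-(p / 4 * |Z u - Z t|))) ∂m with hY
  have h1 : ENNReal.ofReal (A t) ≤ X + ENNReal.ofReal (Df p A B t / 4) := by
    calc ENNReal.ofReal (A t) = ∫⁻ u in Ioo 0 t, 1 ∂m := by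
          rw [lintegral_one, Measure.restrict_apply_univ, S.hA t ht]
      _ ≤ ∫⁻ u in Ioo 0 t, (ENNReal.ofReal (min 1 (t ^ p * u ^ (-p))) *
          ENNReal.ofReal (Real.exp (-(p / 4 * |Z u - Z t|)))
            + ENNReal.ofReal (p / 4) * ENNReal.ofReal (Z t - Z u)) ∂m := by
          apply setLIntegral_mono' measurableSet_Ioo
          intro u hu
          have hu0 := hu.1
          have hm := S.Zmono hu.1 hu.2.le
          have e : (min 1 (t ^ p * u ^ (-p))) = 1 := by
            apply min_eq_left
            rw [Real.rpow_neg hu0.le, ← div_eq_mul_inv, one_le_div (by positivity)]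
            exact Real.rpow_le_rpow hu0.le hu.2.le hp.le
          rw [e, ENNReal.ofReal_one, one_mul, ← ENNReal.ofReal_mul (by positivity)]
          have := exp_help (p / 4) (Z u - Z t) (by positivity)
          have e2 : Z t - Z u = |Z u - Z t| := by
            rw [abs_of_nonpos (by linarith)]; ring
          rw [e2]; exact this
      _ = X + ENNReal.ofReal (p / 4) * ∫⁻ u in Ioo 0 t, ENNReal.ofReal (Z t - Z u) ∂m := by
          rw [lintegral_add_left (by fun_prop), lintegral_const_mul' _ _ ENNReal.ofReal_ne_top]
      _ ≤ X + ENNReal.ofReal (p / 4) * ENNReal.ofReal (Df p A B t / p) := by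
          gcongr
          exact S.G_left ht
      _ = _ := by
          rw [← ENNReal.ofReal_mul (by positivity)]
          congr 2
          field_simp
  have h2 : ENNReal.ofReal (t ^ p * B t) ≤ Y + ENNReal.ofReal (Df p A B t / 4) := by
    calc ENNReal.ofReal (t ^ p * B t) = ∫⁻ u in Ioi t, ENNReal.ofReal (t ^ p) *
            ENNReal.ofReal (u ^ (-p)) ∂m := by
          rw [lintegral_const_mul' _ _ ENNReal.ofReal_ne_top, S.hB t ht,
            ENNReal.ofReal_mul (by positivity)]
      _ ≤ ∫⁻ u in Ioi t, (ENNReal.ofReal (min 1 (t ^ p * u ^ (-p))) *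
          ENNReal.ofReal (Real.exp (-(p / 4 * |Z u - Z t|)))
            + ENNReal.ofReal (p / 4 * t ^ p) *
              (ENNReal.ofReal (u ^ (-p)) * ENNReal.ofReal (Z u - Z t))) ∂m := by
          apply setLIntegral_mono' measurableSet_Ioi
          intro u hu'
          have hu : t < u := hu'
          have hu0 : 0 < u := ht.trans hu
          have hm := S.Zmono ht hu.le
          have e : (min 1 (t ^ p * u ^ (-p))) = t ^ p * u ^ (-p) := by
            apply min_eq_right
            rw [Real.rpow_neg hu0.le, ← div_eq_mul_inv, div_le_one (by positivity)]
            exact Real.rpow_le_rpow ht.le hu.le hp.le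
          have := exp_help (p / 4) (Z u - Z t) (by positivity)
          have e2 : Z u - Z t = |Z u - Z t| := by
            rw [abs_of_nonneg (by linarith)]
          rw [e]
          calc _ = ENNReal.ofReal (t ^ p * u ^ (-p)) * 1 := by
                rw [mul_one, ENNReal.ofReal_mul (by positivity)]
            _ ≤ ENNReal.ofReal (t ^ p * u ^ (-p)) * (ENNReal.ofReal (Real.exp (-(p/4 * |Z u - Z t|))) +
                  ENNReal.ofReal (p/4 * |Z u - Z t|)) := by gcongr
            _ = _ := by
              rw [mul_add, ← e2]
              congr 1
              rw [← ENNReal.ofReal_mul (by positivity), ← ENNReal.ofReal_mul (by positivity),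
                ← ENNReal.ofReal_mul (by positivity)]
              congr 1; ring
      _ = Y + ENNReal.ofReal (p / 4 * t ^ p) *
            ∫⁻ u in Ioi t, ENNReal.ofReal (u ^ (-p)) * ENNReal.ofReal (Z u - Z t) ∂m := by
          rw [lintegral_add_left (by fun_prop), lintegral_const_mul' _ _ ENNReal.ofReal_ne_top]
      _ ≤ Y + ENNReal.ofReal (p / 4 * t ^ p) * ENNReal.ofReal (Ef p A B t / p) := by
          gcongr
          exact S.G_right ht
      _ = _ := by
          rw [← ENNReal.ofReal_mul (by positivity), DE t ht]
          congr 2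
          field_simp
  have h3 : ENNReal.ofReal (Df p A B t / 2) + ENNReal.ofReal (Df p A B t / 2) ≤
      X + Y + ENNReal.ofReal (Df p A B t / 2) := by
    calc _ = ENNReal.ofReal (A t) + ENNReal.ofReal (t ^ p * B t) := by
          rw [← ENNReal.ofReal_add (by positivity) (by positivity),
            ← ENNReal.ofReal_add (by positivity) (by positivity)]
          congr 1
          unfold Df; ring
      _ ≤ _ := add_le_add h1 h2
      _ = X + Y + (ENNReal.ofReal (Df p A B t / 4) + ENNReal.ofReal (Df p A B t / 4)) := by ring
      _ = _ := by
          rw [← ENNReal.ofReal_add (by positivity) (by positivity)]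
          congr 2; ring
  exact (ENNReal.add_le_add_iff_right ENNReal.ofReal_ne_top).1 h3

end Setup

def nuM (p : ℝ) (A B : ℝ → ℝ) : Measure ℝ :=
  (volume.restrict (Ioi 0)).withDensity (fun s => ENNReal.ofReal (zf p A B s))

instance (p : ℝ) (A B : ℝ → ℝ) : SFinite (nuM p A B) := by unfold nuM; infer_instance

def Tg (g : ℝ → ℝ≥0∞) (s : ℝ) : ℝ≥0∞ := ∫⁻ t in Ioi 0, ENNReal.ofReal (s / (s + t)) * g t

lemma measTg (g : ℝ → ℝ≥0∞) (hg : Measurable g) : Measurable (Tg g) := by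
  unfold Tg
  apply Measurable.lintegral_prod_right' (f := fun q : ℝ × ℝ =>
    ENNReal.ofReal (q.1 / (q.1 + q.2)) * g q.2)
  fun_prop

namespace Setup
variable {p : ℝ} {m : Measure ℝ} {A B Z : ℝ → ℝ}

lemma lnu (S : Setup p m A B Z) (h : ℝ → ℝ≥0∞) (hh : Measurable h) :
    ∫⁻ s, h s ∂(nuM p A B) = ∫⁻ s in Ioi 0, ENNReal.ofReal (zf p A B s) * h s := by
  have := S.mz
  unfold nuM
  rw [lintegral_withDensity_eq_lintegral_mul _ (by fun_prop) hh]
  rfl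

lemma nu_pos (S : Setup p m A B Z) : ∀ᵐ s ∂(nuM p A B), 0 < s := by
  have h : nuM p A B ≪ volume.restrict (Ioi 0) := withDensity_absolutelyContinuous _ _
  exact h.ae_le (ae_restrict_mem measurableSet_Ioi)

lemma swapT (S : Setup p m A B Z) (F g : ℝ → ℝ≥0∞) (hF : Measurable F) (hg : Measurable g) :
    ∫⁻ t in Ioi 0, (∫⁻ s, ENNReal.ofReal (s / (s + t)) * F s ∂(nuM p A B)) * g t =
      ∫⁻ s, F s * Tg g s ∂(nuM p A B) := by
  have e1 : ∀ t, (∫⁻ s, ENNReal.ofReal (s / (s + t)) * F s ∂(nuM p A B)) * g t =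
      ∫⁻ s, ENNReal.ofReal (s / (s + t)) * F s * g t ∂(nuM p A B) := fun t =>
    (lintegral_mul_const _ (by fun_prop)).symm
  have e2 : ∀ s, F s * Tg g s = ∫⁻ t in Ioi 0, ENNReal.ofReal (s / (s + t)) * F s * g t := by
    intro s
    unfold Tg
    rw [← lintegral_const_mul _ (by fun_prop)]
    apply lintegral_congr
    intro t; ring
  simp_rw [e1, e2]
  apply lintegral_lintegral_swap
  apply Measurable.aemeasurable
  unfold Function.uncurry
  fun_prop

lemma G_point [SFinite m] [NullSingletonClass m] (S : Setup p m A B Z) (f : ℝ → ℝ≥0∞)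
    (hf1 : AntitoneOn f (Ioi 0)) (hf2 : MonotoneOn (fun t => ENNReal.ofReal t * f t) (Ioi 0))
    {t : ℝ} (ht : 0 < t) :
    f t ^ p * ENNReal.ofReal (Df p A B t / 2) ≤
      ∫⁻ u in Ioi 0, f u ^ p * ENNReal.ofReal (Real.exp (-(p / 4 * |Z u - Z t|))) ∂m := by
  have hp := S.p0
  have hmZ := S.mZ
  calc _ ≤ f t ^ p * _ := mul_le_mul' le_rfl (S.G_ge ht)
    _ = ∫⁻ u in Ioi 0, f t ^ p * (ENNReal.ofReal (min 1 (t ^ p * u ^ (-p))) *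
      ENNReal.ofReal (Real.exp (-(p / 4 * |Z u - Z t|)))) ∂m := by
        rw [lintegral_const_mul _ (by fun_prop)]
    _ ≤ _ := by
      apply setLIntegral_mono' measurableSet_Ioi
      intro u hu'
      have hu : 0 < u := hu'
      rw [← mul_assoc]
      gcongr
      rcases le_total u t with h | h
      · calc f t ^ p * ENNReal.ofReal (min 1 (t ^ p * u ^ (-p))) ≤ f t ^ p * 1 := by
              gcongr
              rw [ENNReal.ofReal_le_one]
              exact min_le_left _ _
          _ = f t ^ p := mul_one _
          _ ≤ f u ^ p := ENNReal.rpow_le_rpow (hf1 hu' ht h) hp.le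
      · have h1 := ENNReal.rpow_le_rpow (hf2 ht hu' h) hp.le
        simp only at h1
        rw [ENNReal.mul_rpow_of_nonneg _ _ hp.le, ENNReal.mul_rpow_of_nonneg _ _ hp.le,
          ENNReal.ofReal_rpow_of_nonneg ht.le hp.le, ENNReal.ofReal_rpow_of_nonneg hu.le hp.le] at h1
        calc f t ^ p * ENNReal.ofReal (min 1 (t ^ p * u ^ (-p)))
            ≤ f t ^ p * ENNReal.ofReal (t ^ p * u ^ (-p)) := by
              gcongr
              exact min_le_right _ _
          _ = (ENNReal.ofReal (t ^ p) * f t ^ p) * ENNReal.ofReal (u ^ (-p)) := by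
              rw [ENNReal.ofReal_mul (by positivity)]; ring
          _ ≤ (ENNReal.ofReal (u ^ p) * f u ^ p) * ENNReal.ofReal (u ^ (-p)) := by gcongr
          _ = f u ^ p * ENNReal.ofReal (u ^ p * u ^ (-p)) := by
              rw [ENNReal.ofReal_mul (by positivity)]; ring
          _ = f u ^ p := by
              rw [← Real.rpow_add hu]; simp

lemma upper [SFinite m] [NullSingletonClass m] (S : Setup p m A B Z) {q : ℝ}
    (hpq : p.HolderConjugate q) :
    ∃ C : ℝ, 0 < C ∧ ∀ f g : ℝ → ℝ≥0∞, Measurable f → Measurable g → AntitoneOn f (Ioi 0) →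
      MonotoneOn (fun t => ENNReal.ofReal t * f t) (Ioi 0) →
      ∫⁻ t in Ioi 0, f t * g t ≤ ENNReal.ofReal C *
        (∫⁻ s, (ENNReal.ofReal (Df p A B s ^ (-(1/p))) * Tg g s) ^ q ∂(nuM p A B)) ^ (1 / q) *
        (∫⁻ t in Ioi 0, f t ^ p ∂m) ^ (1 / p) := by
  have hp := S.p0
  have hmZ := S.mZ
  have hmD := S.mD
  have hmz := S.mz
  set c : ℝ := 1 / (2 * (1 + p + 1/4)) with hc
  have hc0 : 0 < c := by positivity
  refine ⟨(2 ^ (1/p) / c) * (8 / p) ^ (1 / p), by positivity, ?_⟩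
  intro f g hf hg hf1 hf2
  set G : ℝ → ℝ≥0∞ := fun s =>
    ∫⁻ u in Ioi 0, f u ^ p * ENNReal.ofReal (Real.exp (-(p / 4 * |Z u - Z s|))) ∂m with hG
  have mG : Measurable G := by
    apply Measurable.lintegral_prod_right' (f := fun q : ℝ × ℝ =>
      f q.2 ^ p * ENNReal.ofReal (Real.exp (-(p / 4 * |Z q.2 - Z q.1|))))
    fun_prop
  have mT := measTg g hg
  set F : ℝ → ℝ≥0∞ := fun s => G s ^ (1/p) * ENNReal.ofReal (Df p A B s ^ (-(1/p))) with hF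
  have mF : Measurable F := by fun_prop
  -- step b
  have hb : ∀ t, 0 < t → f t ≤ ENNReal.ofReal (2 ^ (1/p)) *
      (G t ^ (1/p) * ENNReal.ofReal (Df p A B t ^ (-(1/p)))) := by
    intro t ht
    have hD := S.Dpos ht
    have h1 := S.G_point f hf1 hf2 ht
    have h2 : f t ^ p ≤ G t * ENNReal.ofReal (2 * (Df p A B t)⁻¹) := by
      calc f t ^ p = f t ^ p * ENNReal.ofReal (Df p A B t / 2) *
            ENNReal.ofReal (2 * (Df p A B t)⁻¹) := by
              rw [mul_assoc, ← ENNReal.ofReal_mul (by positivity)]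
              rw [show Df p A B t / 2 * (2 * (Df p A B t)⁻¹) = 1 by field_simp]
              simp
        _ ≤ _ := by gcongr
    have h3 := ENNReal.rpow_le_rpow h2 (z := 1 / p) (by positivity)
    rw [← ENNReal.rpow_mul, mul_one_div_cancel hp.ne', ENNReal.rpow_one,
      ENNReal.mul_rpow_of_nonneg _ _ (by positivity),
      ENNReal.ofReal_rpow_of_pos (by positivity), Real.mul_rpow (by positivity) (by positivity),
      ENNReal.ofReal_mul (by positivity), Real.inv_rpow hD.le, ← Real.rpow_neg hD.le] at h3
    calc _ ≤ _ := h3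
      _ = _ := by ring
  -- step c
  have hcc : ∀ s t, G t ^ (1/p) * ENNReal.ofReal (Real.exp (-(1/4 * |Z s - Z t|))) ≤ G s ^ (1/p) := by
    intro s t
    have h1 : G t * ENNReal.ofReal (Real.exp (-(p/4 * |Z s - Z t|))) ≤ G s := by
      rw [hG]
      simp only
      rw [← lintegral_mul_const _ (by fun_prop)]
      apply lintegral_mono
      intro u
      simp only
      rw [mul_assoc, ← ENNReal.ofReal_mul (by positivity), ← Real.exp_add]
      gcongr
      have := abs_sub_le (Z u) (Z t) (Z s)
      rw [abs_sub_comm (Z t) (Z s)] at this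
      have := mul_le_mul_of_nonneg_left this (show 0 ≤ p / 4 by positivity)
      linarith
    have h3 := ENNReal.rpow_le_rpow h1 (z := 1 / p) (by positivity)
    rw [ENNReal.mul_rpow_of_nonneg _ _ (by positivity),
      ENNReal.ofReal_rpow_of_pos (by positivity), ← Real.exp_mul] at h3
    convert h3 using 4
    field_simp
  -- step d
  have hd : ∀ t, 0 < t → G t ^ (1/p) * ENNReal.ofReal (c * Df p A B t ^ (-(1/p))) ≤
      ∫⁻ s, ENNReal.ofReal (s / (s + t)) * F s ∂(nuM p A B) := by
    intro t ht
    rw [S.lnu _ (by fun_prop)]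
    calc _ ≤ G t ^ (1/p) * _ := mul_le_mul' le_rfl (S.K_ge (η := 1/4) (by norm_num) ht)
      _ = ∫⁻ s in Ioi 0, G t ^ (1/p) * ENNReal.ofReal (s / (s + t) * Df p A B s ^ (-(1/p)) *
      Real.exp (-(1/4 * |Z s - Z t|)) * zf p A B s) := by
          rw [lintegral_const_mul _ (by fun_prop)]
      _ ≤ _ := by
        apply setLIntegral_mono' measurableSet_Ioi
        intro s hs'
        have hs : 0 < s := hs'
        have hD := S.Dpos hs
        rw [ENNReal.ofReal_mul (by positivity), ENNReal.ofReal_mul (by positivity),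
          ENNReal.ofReal_mul (by positivity)]
        calc _ = ENNReal.ofReal (zf p A B s) * (ENNReal.ofReal (s / (s + t)) *
              ((G t ^ (1/p) * ENNReal.ofReal (Real.exp (-(1/4 * |Z s - Z t|)))) *
                ENNReal.ofReal (Df p A B s ^ (-(1/p))))) := by ring
          _ ≤ _ := by
            rw [hF]
            simp only
            gcongr
            exact hcc s t
  have hft : ∀ t, 0 < t → f t ≤ ENNReal.ofReal (2 ^ (1/p) / c) *
      ∫⁻ s, ENNReal.ofReal (s / (s + t)) * F s ∂(nuM p A B) := by
    intro t ht
    calc f t ≤ _ := hb t ht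
      _ = ENNReal.ofReal (2 ^ (1/p) / c) * (G t ^ (1/p) * ENNReal.ofReal (c * Df p A B t ^ (-(1/p)))) := by
        have e : ENNReal.ofReal (2 ^ (1/p)) = ENNReal.ofReal (2 ^ (1/p) / c) * ENNReal.ofReal c := by
          rw [← ENNReal.ofReal_mul (by positivity)]; congr 1; field_simp
        rw [e, ENNReal.ofReal_mul hc0.le]; ring
      _ ≤ _ := mul_le_mul' le_rfl (hd t ht)
  -- bound of ∫ G
  have hGint : ∫⁻ s, G s ∂(nuM p A B) ≤ (∫⁻ t in Ioi 0, f t ^ p ∂m) * ENNReal.ofReal (8 / p) := by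
    rw [hG, lintegral_lintegral_swap (by
      apply Measurable.aemeasurable
      unfold Function.uncurry
      fun_prop), ← lintegral_mul_const _ (by fun_prop)]
    apply setLIntegral_mono' measurableSet_Ioi
    intro u hu
    rw [lintegral_const_mul _ (by fun_prop)]
    gcongr
    rw [S.lnu _ (by fun_prop)]
    have := S.expInt (ε := p/4) (by positivity) hu
    refine le_trans (le_of_eq ?_) (this.trans (le_of_eq ?_))
    · apply setLIntegral_congr_fun measurableSet_Ioi
      intro s hs
      simp only
      rw [← ENNReal.ofReal_mul (S.zpos hs).le, mul_comm, abs_sub_comm]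
    · congr 1; field_simp; norm_num
  calc ∫⁻ t in Ioi 0, f t * g t
      ≤ ∫⁻ t in Ioi 0, ENNReal.ofReal (2 ^ (1/p) / c) *
        ((∫⁻ s, ENNReal.ofReal (s / (s + t)) * F s ∂(nuM p A B)) * g t) := by
        apply setLIntegral_mono' measurableSet_Ioi
        intro t ht
        rw [← mul_assoc]
        gcongr
        exact hft t ht
    _ = ENNReal.ofReal (2 ^ (1/p) / c) * ∫⁻ s, F s * Tg g s ∂(nuM p A B) := by
        rw [lintegral_const_mul' _ _ ENNReal.ofReal_ne_top, S.swapT F g mF hg]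
    _ = ENNReal.ofReal (2 ^ (1/p) / c) * ∫⁻ s, ((fun s => G s ^ (1/p)) *
          (fun s => ENNReal.ofReal (Df p A B s ^ (-(1/p))) * Tg g s)) s ∂(nuM p A B) := by
        congr 2
        ext s
        simp only [hF, Pi.mul_apply]; ring
    _ ≤ ENNReal.ofReal (2 ^ (1/p) / c) * ((∫⁻ s, (G s ^ (1/p)) ^ p ∂(nuM p A B)) ^ (1/p) *
          (∫⁻ s, (ENNReal.ofReal (Df p A B s ^ (-(1/p))) * Tg g s) ^ q ∂(nuM p A B)) ^ (1/q)) := by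
        gcongr
        exact ENNReal.lintegral_mul_le_Lp_mul_Lq _ hpq (by fun_prop) (by fun_prop)
    _ ≤ ENNReal.ofReal (2 ^ (1/p) / c) *
          (((∫⁻ t in Ioi 0, f t ^ p ∂m) * ENNReal.ofReal (8 / p)) ^ (1/p) *
          (∫⁻ s, (ENNReal.ofReal (Df p A B s ^ (-(1/p))) * Tg g s) ^ q ∂(nuM p A B)) ^ (1/q)) := by
        gcongr
        refine le_trans (le_of_eq ?_) hGint
        congr 1; ext s
        rw [← ENNReal.rpow_mul, one_div_mul_cancel hp.ne', ENNReal.rpow_one]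
    _ = _ := by
        rw [ENNReal.mul_rpow_of_nonneg _ _ (by positivity),
          ENNReal.ofReal_rpow_of_pos (by positivity), ENNReal.ofReal_mul (by positivity)]
        ring

end Setup


namespace Setup
variable {p : ℝ} {m : Measure ℝ} {A B Z : ℝ → ℝ}

def Ff (p : ℝ) (A B : ℝ → ℝ) (F : ℝ → ℝ≥0∞) (t : ℝ) : ℝ≥0∞ :=
  ∫⁻ s, ENNReal.ofReal (s / (s + t)) * F s ∂(nuM p A B)

lemma mFf (F : ℝ → ℝ≥0∞) (hF : Measurable F) : Measurable (Ff p A B F) := by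
  unfold Ff
  apply Measurable.lintegral_prod_right' (f := fun q : ℝ × ℝ =>
    ENNReal.ofReal (q.2 / (q.2 + q.1)) * F q.2)
  fun_prop

lemma Ff_anti (S : Setup p m A B Z) (F : ℝ → ℝ≥0∞) : AntitoneOn (Ff p A B F) (Ioi 0) := by
  intro a ha b hb hab
  have ha' : 0 < a := ha
  unfold Ff
  apply lintegral_mono_ae
  filter_upwards [S.nu_pos] with s hs
  gcongr

lemma Ff_mono (S : Setup p m A B Z) (F : ℝ → ℝ≥0∞) :
    MonotoneOn (fun t => ENNReal.ofReal t * Ff p A B F t) (Ioi 0) := by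
  intro a ha b hb hab
  have ha' : 0 < a := ha
  have hb' : 0 < b := hb
  simp only
  unfold Ff
  rw [← lintegral_const_mul' _ _ ENNReal.ofReal_ne_top,
    ← lintegral_const_mul' _ _ ENNReal.ofReal_ne_top]
  apply lintegral_mono_ae
  filter_upwards [S.nu_pos] with s hs
  rw [← mul_assoc, ← mul_assoc, ← ENNReal.ofReal_mul ha'.le, ← ENNReal.ofReal_mul hb'.le]
  refine mul_le_mul' (ENNReal.ofReal_le_ofReal ?_) le_rfl
  rw [← mul_div_assoc, ← mul_div_assoc, div_le_div_iff₀ (by positivity) (by positivity)]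
  nlinarith [mul_nonneg (mul_pos hs hs).le (sub_nonneg.2 hab)]

lemma schur_pt (S : Setup p m A B Z) {q : ℝ} (hpq : p.HolderConjugate q)
    (F : ℝ → ℝ≥0∞) (hF : Measurable F) {t : ℝ} (ht : 0 < t) :
    Ff p A B F t ^ p ≤ (∫⁻ s, ENNReal.ofReal (s / (s + t)) * (ENNReal.ofReal (Df p A B s ^ (-(1/p))) *
      (F s ^ p * ENNReal.ofReal (Df p A B s))) ∂(nuM p A B)) *
      ENNReal.ofReal (2 ^ (p - 1) * Df p A B t ^ (-(1 - 1/p))) := by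
  have hp := S.p0
  have hmD := S.mD
  have hmz := S.mz
  have hDt := S.Dpos ht
  set w : ℝ → ℝ≥0∞ := fun s => ENNReal.ofReal (s / (s + t)) * ENNReal.ofReal (Df p A B s ^ (-(1/p)))
    with hw
  have mw : Measurable w := by fun_prop
  set G : ℝ → ℝ≥0∞ := fun s => F s * ENNReal.ofReal (Df p A B s ^ (1/p)) with hG
  have mG : Measurable G := by fun_prop
  have e1 : Ff p A B F t = ∫⁻ s, (G * 1) s ∂((nuM p A B).withDensity w) := by
    rw [lintegral_withDensity_eq_lintegral_mul _ mw (by fun_prop)]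
    unfold Ff
    apply lintegral_congr_ae
    filter_upwards [S.nu_pos] with s hs
    have hD := S.Dpos hs
    have : ENNReal.ofReal (Df p A B s ^ (-(1/p))) * ENNReal.ofReal (Df p A B s ^ (1/p)) = 1 := by
      rw [← ENNReal.ofReal_mul (by positivity), ← Real.rpow_add hD]; simp
    simp only [hw, hG, Pi.mul_apply, Pi.one_apply, mul_one]
    calc _ = ENNReal.ofReal (s / (s + t)) * F s * 1 := by ring
      _ = _ := by rw [← this]; ring
  have e2 : ∫⁻ s, G s ^ p ∂((nuM p A B).withDensity w) =
      ∫⁻ s, ENNReal.ofReal (s / (s + t)) * (ENNReal.ofReal (Df p A B s ^ (-(1/p))) *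
      (F s ^ p * ENNReal.ofReal (Df p A B s))) ∂(nuM p A B) := by
    rw [lintegral_withDensity_eq_lintegral_mul _ mw (by fun_prop)]
    apply lintegral_congr_ae
    filter_upwards [S.nu_pos] with s hs
    have hD := S.Dpos hs
    simp only [hw, hG, Pi.mul_apply]
    rw [ENNReal.mul_rpow_of_nonneg _ _ hp.le, ENNReal.ofReal_rpow_of_pos (by positivity),
      ← Real.rpow_mul hD.le, one_div_mul_cancel hp.ne', Real.rpow_one]
    ring
  have e3 : ∫⁻ s, (1 : ℝ → ℝ≥0∞) s ^ q ∂((nuM p A B).withDensity w) ≤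
      ENNReal.ofReal (2 * Df p A B t ^ (-(1/p))) := by
    simp only [Pi.one_apply, ENNReal.one_rpow]
    rw [lintegral_withDensity_eq_lintegral_mul _ mw (by fun_prop), S.lnu _ (by fun_prop)]
    refine le_trans (le_of_eq ?_) (S.S1 ht)
    apply setLIntegral_congr_fun measurableSet_Ioi
    intro s hs'
    have hs : 0 < s := hs'
    have hD := S.Dpos hs
    simp only [hw, Pi.mul_apply, mul_one]
    rw [← ENNReal.ofReal_mul (by positivity), ← ENNReal.ofReal_mul (S.zpos hs).le, mul_comm]
  have h1 := ENNReal.lintegral_mul_le_Lp_mul_Lq ((nuM p A B).withDensity w) hpq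
    (f := G) (g := 1) (by fun_prop) (by fun_prop)
  rw [← e1, e2] at h1
  have h2 := ENNReal.rpow_le_rpow h1 hp.le
  refine h2.trans ?_
  rw [ENNReal.mul_rpow_of_nonneg _ _ hp.le, ← ENNReal.rpow_mul, one_div_mul_cancel hp.ne',
    ENNReal.rpow_one]
  gcongr
  rw [← ENNReal.rpow_mul]
  have hq : 1 / q * p = p - 1 := by
    rw [← hpq.div_conj_eq_sub_one]; ring
  rw [hq]
  refine (ENNReal.rpow_le_rpow e3 (by linarith [S.hp])).trans (le_of_eq ?_)
  rw [ENNReal.ofReal_rpow_of_pos (by positivity), Real.mul_rpow (by positivity) (by positivity),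
    ← Real.rpow_mul hDt.le]
  congr 3
  field_simp

lemma schur [SFinite m] [NullSingletonClass m] (S : Setup p m A B Z) {q : ℝ}
    (hpq : p.HolderConjugate q) (F : ℝ → ℝ≥0∞) (hF : Measurable F) :
    ∫⁻ t in Ioi 0, Ff p A B F t ^ p ∂m ≤ ENNReal.ofReal (2 ^ (p - 1) * (2 * p)) *
      ∫⁻ s, F s ^ p * ENNReal.ofReal (Df p A B s) ∂(nuM p A B) := by
  have hp := S.p0
  have hmD := S.mD
  have hmz := S.mz
  calc _ ≤ ∫⁻ t in Ioi 0, (∫⁻ s, ENNReal.ofReal (s / (s + t)) *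
        (ENNReal.ofReal (Df p A B s ^ (-(1/p))) *
      (F s ^ p * ENNReal.ofReal (Df p A B s))) ∂(nuM p A B)) *
      ENNReal.ofReal (2 ^ (p - 1) * Df p A B t ^ (-(1 - 1/p))) ∂m :=
        setLIntegral_mono' measurableSet_Ioi fun t ht => S.schur_pt hpq F hF ht
    _ = ∫⁻ t in Ioi 0, ∫⁻ s, ENNReal.ofReal (s / (s + t)) *
        (ENNReal.ofReal (Df p A B s ^ (-(1/p))) *
      (F s ^ p * ENNReal.ofReal (Df p A B s))) *
      ENNReal.ofReal (2 ^ (p - 1) * Df p A B t ^ (-(1 - 1/p))) ∂(nuM p A B) ∂m := by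
        congr 1; ext t
        rw [lintegral_mul_const _ (by fun_prop)]
    _ = ∫⁻ s, ∫⁻ t in Ioi 0, ENNReal.ofReal (s / (s + t)) *
        (ENNReal.ofReal (Df p A B s ^ (-(1/p))) *
      (F s ^ p * ENNReal.ofReal (Df p A B s))) *
      ENNReal.ofReal (2 ^ (p - 1) * Df p A B t ^ (-(1 - 1/p))) ∂m ∂(nuM p A B) := by
        apply lintegral_lintegral_swap
        apply Measurable.aemeasurable
        unfold Function.uncurry
        fun_prop
    _ ≤ ∫⁻ s, ENNReal.ofReal (2 ^ (p - 1) * (2 * p)) *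
          (F s ^ p * ENNReal.ofReal (Df p A B s)) ∂(nuM p A B) := by
        apply lintegral_mono_ae
        filter_upwards [S.nu_pos] with s hs
        have hD := S.Dpos hs
        calc _ = ∫⁻ t in Ioi 0, (ENNReal.ofReal (2 ^ (p - 1) * Df p A B s ^ (-(1/p))) *
              (F s ^ p * ENNReal.ofReal (Df p A B s))) *
              ENNReal.ofReal (s / (s + t) * Df p A B t ^ (-(1 - 1/p))) ∂m := by
                apply setLIntegral_congr_fun measurableSet_Ioi
                intro t ht'
                have ht : 0 < t := ht'
                have := S.Dpos ht
                simp only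
                rw [ENNReal.ofReal_mul (by positivity), ENNReal.ofReal_mul (by positivity),
                  ENNReal.ofReal_mul (by positivity)]
                ring
          _ ≤ (ENNReal.ofReal (2 ^ (p - 1) * Df p A B s ^ (-(1/p))) *
              (F s ^ p * ENNReal.ofReal (Df p A B s))) *
                ENNReal.ofReal (2 * p * Df p A B s ^ (1 / p)) := by
              rw [lintegral_const_mul _ (by fun_prop)]
              gcongr
              exact S.S2 hs
          _ = ENNReal.ofReal (2 ^ (p - 1) * (2 * p)) *
            (ENNReal.ofReal (Df p A B s ^ (-(1/p)) * Df p A B s ^ (1 / p))) *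
              (F s ^ p * ENNReal.ofReal (Df p A B s)) := by
              rw [ENNReal.ofReal_mul (p := 2 ^ (p - 1)) (q := Df p A B s ^ (-(1/p))) (by positivity),
                ENNReal.ofReal_mul (p := 2 * p) (by positivity),
                ENNReal.ofReal_mul (p := 2 ^ (p - 1)) (q := 2 * p) (by positivity),
                ENNReal.ofReal_mul (p := Df p A B s ^ (-(1/p))) (by positivity)]
              ring
          _ = _ := by
              rw [← Real.rpow_add hD]; simp
    _ = _ := by rw [lintegral_const_mul _ (by fun_prop)]

lemma lower [SFinite m] [NullSingletonClass m] (S : Setup p m A B Z) {q : ℝ}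
    (hpq : p.HolderConjugate q) :
    ∃ C : ℝ, 0 < C ∧ ∀ g : ℝ → ℝ≥0∞, Measurable g → ∀ M : ℝ≥0∞,
      (∀ f : ℝ → ℝ≥0∞, Measurable f → AntitoneOn f (Ioi 0) →
        MonotoneOn (fun t => ENNReal.ofReal t * f t) (Ioi 0) →
        ∫⁻ t in Ioi 0, f t ^ p ∂m ≠ ⊤ →
        ∫⁻ t in Ioi 0, f t * g t ≤ M * (∫⁻ t in Ioi 0, f t ^ p ∂m) ^ (1 / p)) →
      (∫⁻ s, (ENNReal.ofReal (Df p A B s ^ (-(1/p))) * Tg g s) ^ q ∂(nuM p A B)) ^ (1 / q) ≤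
        ENNReal.ofReal C * M := by
  have hp := S.p0
  have hq : 0 < q := hpq.symm.pos
  have hq1 : 1 < q := hpq.symm.lt
  have hpq1 : (q - 1) * p = q := by
    have := hpq.mul_eq_add
    nlinarith
  have hmD := S.mD
  have hmz := S.mz
  set K : ℝ := 2 ^ (p - 1) * (2 * p) with hK
  have hK0 : 0 < K := by positivity
  refine ⟨K ^ (1/p), by positivity, ?_⟩
  intro g hg M hM
  have mT := measTg g hg
  set h : ℝ → ℝ≥0∞ := fun s => ENNReal.ofReal (Df p A B s ^ (-(1/p))) * Tg g s with hh
  have mh : Measurable h := by fun_prop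
  set κ : ℕ → ℝ → ℝ≥0∞ := fun n => (Icc (1/((n:ℝ)+1)) ((n:ℝ)+1)).indicator (fun s => min (h s) n)
    with hκ
  have mκ : ∀ n, Measurable (κ n) := fun n =>
    (mh.min measurable_const).indicator measurableSet_Icc
  have κle : ∀ n s, κ n s ≤ h s := by
    intro n s
    simp only [hκ]
    exact (indicator_le_self _ (fun s => min (h s) (n:ℝ≥0∞)) s).trans (min_le_left _ _)
  have κn : ∀ n s, κ n s ≤ (Icc (1/((n:ℝ)+1)) ((n:ℝ)+1)).indicator (fun _ => (n : ℝ≥0∞)) s := by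
    intro n s
    simp only [hκ]
    apply indicator_le_indicator (min_le_right _ _)
  have Ifin : ∀ n, ∫⁻ s, κ n s ^ q ∂(nuM p A B) ≠ ⊤ := by
    intro n
    have hn0 : (0:ℝ) < 1 / ((n:ℝ)+1) := by positivity
    have hsub : Icc (1/((n:ℝ)+1)) ((n:ℝ)+1) ⊆ Ioi 0 := fun x hx => lt_of_lt_of_le hn0 hx.1
    have hfin : nuM p A B (Icc (1/((n:ℝ)+1)) ((n:ℝ)+1)) ≠ ⊤ := by
      unfold nuM
      rw [withDensity_apply _ measurableSet_Icc, Measure.restrict_restrict measurableSet_Icc,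
        inter_eq_left.2 hsub]
      have : IntegrableOn (zf p A B) (Icc (1/((n:ℝ)+1)) ((n:ℝ)+1)) :=
        (S.zcont.mono hsub).integrableOn_compact isCompact_Icc
      exact this.lintegral_lt_top.ne
    have : ∫⁻ s, κ n s ^ q ∂(nuM p A B) ≤ (n:ℝ≥0∞) ^ q * nuM p A B (Icc (1/((n:ℝ)+1)) ((n:ℝ)+1)) := by
      rw [← lintegral_indicator_const measurableSet_Icc]
      apply lintegral_mono
      intro s
      refine (ENNReal.rpow_le_rpow (κn n s) hq.le).trans ?_
      by_cases hs : s ∈ Icc (1/((n:ℝ)+1)) ((n:ℝ)+1)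
      · rw [indicator_of_mem hs, indicator_of_mem hs]
      · rw [indicator_of_notMem hs, indicator_of_notMem hs, ENNReal.zero_rpow_of_pos hq]
    refine ne_top_of_le_ne_top ?_ this
    exact ENNReal.mul_ne_top (ENNReal.rpow_ne_top_of_nonneg hq.le (by simp)) hfin
  have key : ∀ n, (∫⁻ s, κ n s ^ q ∂(nuM p A B)) ^ (1/q) ≤ ENNReal.ofReal (K ^ (1/p)) * M := by
    intro n
    set I := ∫⁻ s, κ n s ^ q ∂(nuM p A B) with hI
    have mκn := mκ n
    set F : ℝ → ℝ≥0∞ := fun s => ENNReal.ofReal (Df p A B s ^ (-(1/p))) * κ n s ^ (q - 1) with hF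
    have mF : Measurable F := by fun_prop
    have hFp : ∫⁻ s, F s ^ p * ENNReal.ofReal (Df p A B s) ∂(nuM p A B) = I := by
      apply lintegral_congr_ae
      filter_upwards [S.nu_pos] with s hs
      have hD := S.Dpos hs
      simp only [hF]
      rw [ENNReal.mul_rpow_of_nonneg _ _ hp.le, ENNReal.ofReal_rpow_of_pos (by positivity),
        ← Real.rpow_mul hD.le, ← ENNReal.rpow_mul, hpq1]
      rw [show -(1/p) * p = -1 by field_simp, Real.rpow_neg_one, mul_right_comm,
        ← ENNReal.ofReal_mul (by positivity), inv_mul_cancel₀ hD.ne']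
      simp
    have hs := S.schur hpq F mF
    rw [hFp] at hs
    have hfin : ∫⁻ t in Ioi 0, Ff p A B F t ^ p ∂m ≠ ⊤ :=
      ne_top_of_le_ne_top (ENNReal.mul_ne_top ENNReal.ofReal_ne_top (Ifin n)) hs
    have h1 := hM (Ff p A B F) (mFf F mF) (S.Ff_anti F) (S.Ff_mono F) hfin
    have h2 : I ≤ ∫⁻ t in Ioi 0, Ff p A B F t * g t := by
      unfold Ff
      rw [S.swapT F g mF hg]
      apply lintegral_mono
      intro s
      simp only [hF]
      calc κ n s ^ q = κ n s ^ (q - 1) * κ n s := by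
            nth_rewrite 3 [← ENNReal.rpow_one (κ n s)]
            rw [← ENNReal.rpow_add_of_nonneg _ _ (by linarith) (by norm_num)]
            congr 1; ring
        _ ≤ κ n s ^ (q - 1) * h s := by gcongr; exact κle n s
        _ = _ := by simp only [hh]; ring
    have h3 : I ≤ ENNReal.ofReal (K ^ (1/p)) * M * I ^ (1/p) := by
      calc I ≤ _ := h2.trans h1
        _ ≤ M * (ENNReal.ofReal K * I) ^ (1/p) := by gcongr
        _ = _ := by
          rw [ENNReal.mul_rpow_of_nonneg _ _ (by positivity), ENNReal.ofReal_rpow_of_pos hK0]; ring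
    rcases eq_or_ne I 0 with h0 | h0
    · rw [h0, ENNReal.zero_rpow_of_pos (by positivity)]; exact zero_le
    · have e : I = I ^ (1/q) * I ^ (1/p) := by
        rw [← ENNReal.rpow_add _ _ h0 (Ifin n)]
        have : 1/q + 1/p = 1 := by
          have := hpq.inv_add_inv_eq_one; simp only [one_div]; linarith
        rw [this, ENNReal.rpow_one]
      have h4 : I ^ (1/q) * I ^ (1/p) ≤ ENNReal.ofReal (K ^ (1/p)) * M * I ^ (1/p) := by
        rw [← e]; exact h3
      exact (ENNReal.mul_le_mul_iff_left (by
        rw [Ne, ENNReal.rpow_eq_zero_iff_of_pos (by positivity)]; exact h0)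
        (ENNReal.rpow_ne_top_of_nonneg (by positivity) (Ifin n))).1 h4
  have lim : Tendsto (fun n => ∫⁻ s, κ n s ^ q ∂(nuM p A B)) atTop
      (nhds (∫⁻ s, h s ^ q ∂(nuM p A B))) := by
    apply lintegral_tendsto_of_tendsto_of_monotone
    · intro n
      have := mκ n
      fun_prop
    · refine Filter.Eventually.of_forall fun s => ?_
      intro a b hab
      simp only
      apply ENNReal.rpow_le_rpow _ hq.le
      have hab' : (a:ℝ) ≤ b := by exact_mod_cast hab
      simp only [hκ]
      have hsub : Icc (1/((a:ℝ)+1)) ((a:ℝ)+1) ⊆ Icc (1/((b:ℝ)+1)) ((b:ℝ)+1) := by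
        apply Icc_subset_Icc
        · gcongr
        · gcongr
      refine (indicator_le_indicator_of_subset hsub (fun _ => zero_le) s).trans ?_
      apply indicator_le_indicator
      gcongr
    · filter_upwards [S.nu_pos] with s hs
      have hmem : ∀ᶠ n : ℕ in atTop, s ∈ Icc (1/((n:ℝ)+1)) ((n:ℝ)+1) := by
        obtain ⟨N, hN⟩ := exists_nat_gt (max s (1/s))
        filter_upwards [eventually_ge_atTop N] with n hn
        have hn' : (N:ℝ) ≤ n := by exact_mod_cast hn
        have h1 := (le_max_left s (1/s)).trans hN.le
        have h2 := (le_max_right s (1/s)).trans hN.le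
        constructor
        · rw [one_div_le (by positivity) hs]; linarith
        · linarith
      have hlim : Tendsto (fun n : ℕ => min (h s) (n : ℝ≥0∞)) atTop (nhds (h s)) := by
        have := (tendsto_const_nhds (x := h s)).min ENNReal.tendsto_nat_nhds_top
        simpa using this
      have : Tendsto (fun n => κ n s) atTop (nhds (h s)) := by
        refine hlim.congr' ?_
        filter_upwards [hmem] with n hn
        simp only [hκ]; rw [indicator_of_mem hn]
      exact (ENNReal.continuous_rpow_const.tendsto _).comp this
  have lim2 := (ENNReal.continuous_rpow_const (y := 1/q)).tendsto _ |>.comp lim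
  exact le_of_tendsto' lim2 key

end Setup

structure Hyp (p : ℝ) (φ : ℝ → ℝ≥0∞) : Prop where
  hp : 1 < p
  mφ : Measurable φ
  pos : ∀ t, 0 < t → 0 < φ t
  loc : ∀ a c : ℝ, 0 < a → ∫⁻ t in Icc a c, φ t < ⊤
  tail1 : ∫⁻ t in Ioi (1 : ℝ), φ t * ENNReal.ofReal (t ^ (-p)) < ⊤
  tail0 : tailP ⊤ p φ 0 = ⊤
  afin : ∀ t, 0 < t → intPhi φ t < ⊤
  inf : ∫⁻ t in Ioi (0 : ℝ), φ t = ⊤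

lemma tailEq (p : ℝ) (φ : ℝ → ℝ≥0∞) (t : ℝ) :
    tailP ⊤ p φ t = ∫⁻ s in Ioi t, φ s * ENNReal.ofReal (s ^ (-p)) := by
  unfold tailP
  congr 2
  ext s; simp

def mM (φ : ℝ → ℝ≥0∞) : Measure ℝ := (volume.restrict (Ioi 0)).withDensity φ

instance (φ : ℝ → ℝ≥0∞) : SFinite (mM φ) := by unfold mM; infer_instance

instance (φ : ℝ → ℝ≥0∞) : NullSingletonClass (mM φ) := by
  unfold mM
  refine ⟨fun x => ?_⟩
  exact withDensity_absolutelyContinuous _ _ (measure_singleton x)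

def AA (φ : ℝ → ℝ≥0∞) (t : ℝ) : ℝ := (intPhi φ t).toReal
def BB (p : ℝ) (φ : ℝ → ℝ≥0∞) (t : ℝ) : ℝ := (tailP ⊤ p φ t).toReal
def ZZ (p : ℝ) (φ : ℝ → ℝ≥0∞) : ℝ → ℝ :=
  (Ioi 0).piecewise (fun t => ∫ s in (1 : ℝ)..t, zf p (AA φ) (BB p φ) s) (fun _ => 0)

namespace Hyp
variable {p : ℝ} {φ : ℝ → ℝ≥0∞}

lemma A_add (a b : ℝ) (ha : 0 < a) (hab : a ≤ b) :
    intPhi φ b = intPhi φ a + ∫⁻ s in Ioc a b, φ s := by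
  unfold intPhi
  rw [setLIntegral_congr Ioo_ae_eq_Ioc, setLIntegral_congr (Ioo_ae_eq_Ioc (a := 0) (b := a)),
    ← lintegral_union measurableSet_Ioc (Ioc_disjoint_Ioc_of_le le_rfl),
    Ioc_union_Ioc_eq_Ioc ha.le hab]

lemma B_add (a b : ℝ) (hab : a ≤ b) :
    tailP ⊤ p φ a = (∫⁻ s in Ioc a b, φ s * ENNReal.ofReal (s ^ (-p))) + tailP ⊤ p φ b := by
  rw [tailEq, tailEq, ← lintegral_union measurableSet_Ioi, Ioc_union_Ioi_eq_Ioi hab]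
  rw [Set.disjoint_left]
  intro x hx hx'
  exact absurd hx.2 (not_le.2 hx')

lemma Nle (H : Hyp p φ) (a b : ℝ) (ha : 0 < a) :
    ENNReal.ofReal (a ^ p) * (∫⁻ s in Ioc a b, φ s * ENNReal.ofReal (s ^ (-p))) ≤
      ∫⁻ s in Ioc a b, φ s := by
  have hp := H.hp
  rw [← lintegral_const_mul' _ _ ENNReal.ofReal_ne_top]
  apply setLIntegral_mono' measurableSet_Ioc
  intro s hs
  have hs0 : 0 < s := ha.trans hs.1
  calc _ = φ s * ENNReal.ofReal (a ^ p * s ^ (-p)) := by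
        rw [ENNReal.ofReal_mul (by positivity)]; ring
    _ ≤ φ s * 1 := by
        gcongr
        rw [ENNReal.ofReal_le_one, Real.rpow_neg hs0.le, ← div_eq_mul_inv, div_le_one (by positivity)]
        exact Real.rpow_le_rpow ha.le hs.1.le (by linarith)
    _ = _ := mul_one _

lemma leN (H : Hyp p φ) (a b : ℝ) (ha : 0 < a) (hb : 0 < b) :
    ∫⁻ s in Ioc a b, φ s ≤
    ENNReal.ofReal (b ^ p) * (∫⁻ s in Ioc a b, φ s * ENNReal.ofReal (s ^ (-p))) := by
  have hp := H.hp
  rw [← lintegral_const_mul' _ _ ENNReal.ofReal_ne_top]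
  apply setLIntegral_mono' measurableSet_Ioc
  intro s hs
  have hs0 : 0 < s := ha.trans hs.1
  calc φ s = φ s * 1 := (mul_one _).symm
    _ ≤ φ s * ENNReal.ofReal (b ^ p * s ^ (-p)) := by
        gcongr
        rw [ENNReal.one_le_ofReal, Real.rpow_neg hs0.le, ← div_eq_mul_inv, one_le_div (by positivity)]
        exact Real.rpow_le_rpow hs0.le hs.2 (by linarith)
    _ = _ := by rw [ENNReal.ofReal_mul (by positivity)]; ring

lemma phifin (H : Hyp p φ) (a b : ℝ) (ha : 0 < a) : ∫⁻ s in Ioc a b, φ s < ⊤ :=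
  (lintegral_mono_set Ioc_subset_Icc_self).trans_lt (H.loc a b ha)

lemma Nfin (H : Hyp p φ) (a b : ℝ) (ha : 0 < a) :
    ∫⁻ s in Ioc a b, φ s * ENNReal.ofReal (s ^ (-p)) < ⊤ := by
  have h := (H.Nle a b ha).trans_lt (H.phifin a b ha)
  by_contra hc
  rw [not_lt, top_le_iff] at hc
  rw [hc, ENNReal.mul_top] at h
  · exact absurd h (lt_irrefl _)
  · rw [Ne, ENNReal.ofReal_eq_zero, not_le]; positivity

lemma tfin (H : Hyp p φ) (t : ℝ) (ht : 0 < t) : tailP ⊤ p φ t < ⊤ := by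
  have h1 : tailP ⊤ p φ 1 < ⊤ := by rw [tailEq]; exact H.tail1
  rcases le_total t 1 with h | h
  · rw [B_add t 1 h]
    exact ENNReal.add_lt_top.2 ⟨H.Nfin t 1 ht, h1⟩
  · refine lt_of_le_of_lt ?_ h1
    rw [B_add 1 t h]; exact le_add_self

lemma A_sub (H : Hyp p φ) (a b : ℝ) (ha : 0 < a) (hab : a ≤ b) :
    AA φ b - AA φ a = (∫⁻ s in Ioc a b, φ s).toReal := by
  unfold AA
  rw [A_add a b ha hab, ENNReal.toReal_add (H.afin a ha).ne (H.phifin a b ha).ne]; ring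

lemma B_sub (H : Hyp p φ) (a b : ℝ) (ha : 0 < a) (hab : a ≤ b) :
    BB p φ a - BB p φ b = (∫⁻ s in Ioc a b, φ s * ENNReal.ofReal (s ^ (-p))).toReal := by
  unfold BB
  rw [B_add a b hab, ENNReal.toReal_add (H.Nfin a b ha).ne (H.tfin b (ha.trans_le hab)).ne]; ring

lemma ABle (H : Hyp p φ) (a b : ℝ) (ha : 0 < a) (hab : a ≤ b) :
    a ^ p * (BB p φ a - BB p φ b) ≤ AA φ b - AA φ a := by
  rw [H.A_sub a b ha hab, H.B_sub a b ha hab]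
  have := ENNReal.toReal_mono (H.phifin a b ha).ne (H.Nle a b ha)
  rwa [ENNReal.toReal_mul, ENNReal.toReal_ofReal (by positivity)] at this

lemma leAB (H : Hyp p φ) (a b : ℝ) (ha : 0 < a) (hab : a ≤ b) :
    AA φ b - AA φ a ≤ b ^ p * (BB p φ a - BB p φ b) := by
  have hb := ha.trans_le hab
  rw [H.A_sub a b ha hab, H.B_sub a b ha hab]
  have := ENNReal.toReal_mono (ENNReal.mul_ne_top ENNReal.ofReal_ne_top (H.Nfin a b ha).ne)
    (H.leN a b ha hb)
  rwa [ENNReal.toReal_mul, ENNReal.toReal_ofReal (by positivity)] at this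

lemma Amono (H : Hyp p φ) (a b : ℝ) (ha : 0 < a) (hab : a ≤ b) : AA φ a ≤ AA φ b := by
  have := H.A_sub a b ha hab
  have : 0 ≤ AA φ b - AA φ a := by rw [this]; exact ENNReal.toReal_nonneg
  linarith

lemma Banti (H : Hyp p φ) (a b : ℝ) (ha : 0 < a) (hab : a ≤ b) : BB p φ b ≤ BB p φ a := by
  have := H.B_sub a b ha hab
  have : 0 ≤ BB p φ a - BB p φ b := by rw [this]; exact ENNReal.toReal_nonneg
  linarith

lemma Apos (H : Hyp p φ) (t : ℝ) (ht : 0 < t) : 0 < AA φ t := by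
  unfold AA
  refine ENNReal.toReal_pos ?_ (H.afin t ht).ne
  rw [← pos_iff_ne_zero]
  unfold intPhi
  rw [setLIntegral_pos_iff H.mφ]
  have : Function.support φ ∩ Ioo 0 t = Ioo 0 t :=
    inter_eq_right.2 fun x hx => (H.pos x hx.1).ne'
  rw [this]; simpa using ht

lemma Bpos (H : Hyp p φ) (t : ℝ) (ht : 0 < t) : 0 < BB p φ t := by
  have := H.mφ
  unfold BB
  refine ENNReal.toReal_pos ?_ (H.tfin t ht).ne
  rw [← pos_iff_ne_zero, tailEq, setLIntegral_pos_iff (by fun_prop)]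
  have : Function.support (fun s => φ s * ENNReal.ofReal (s ^ (-p))) ∩ Ioi t = Ioi t := by
    refine inter_eq_right.2 fun x hx => ?_
    have hx0 : 0 < x := ht.trans hx
    refine mul_ne_zero (H.pos x hx0).ne' ?_
    rw [Ne, ENNReal.ofReal_eq_zero, not_le]; positivity
  rw [this]; simp

lemma Acont (H : Hyp p φ) : ContinuousOn (AA φ) (Ioi 0) := by
  intro t ht'
  have ht : 0 < t := ht'
  apply ContinuousAt.continuousWithinAt
  have hfin : ∫⁻ s in Ioc 0 (t+1), φ s ≠ ⊤ := by
    have := (H.afin (t+1) (by linarith)).ne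
    unfold intPhi at this
    rwa [setLIntegral_congr Ioo_ae_eq_Ioc] at this
  have hIntg : IntervalIntegrable (fun s => (φ s).toReal) volume 0 (t+1) := by
    rw [intervalIntegrable_iff_integrableOn_Ioc_of_le (by linarith)]
    exact integrable_toReal_of_lintegral_ne_top H.mφ.aemeasurable hfin
  have hc := intervalIntegral.continuousOn_primitive_interval' hIntg (left_mem_uIcc)
  have hc2 := hc.continuousAt (x := t) (by
    rw [uIcc_of_le (by linarith)]; exact Icc_mem_nhds ht (by linarith))
  refine hc2.congr ?_
  filter_upwards [Ioo_mem_nhds ht (show t < t + 1 by linarith)] with y hy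
  unfold AA intPhi
  rw [setLIntegral_congr Ioo_ae_eq_Ioc, intervalIntegral.integral_of_le hy.1.le,
    integral_toReal H.mφ.aemeasurable]
  apply ae_lt_top' H.mφ.aemeasurable
  exact ne_top_of_le_ne_top hfin (lintegral_mono_set (Ioc_subset_Ioc_right hy.2.le))

lemma Bcont (H : Hyp p φ) : ContinuousOn (BB p φ) (Ioi 0) := by
  intro t ht'
  have ht : 0 < t := ht'
  apply ContinuousAt.continuousWithinAt
  have hA := H.Acont.continuousAt (Ioi_mem_nhds ht)
  have hc : 0 < (t/2)^p := by positivity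
  unfold ContinuousAt
  rw [tendsto_iff_dist_tendsto_zero] 
  have h1 : Tendsto (fun y => ((t/2)^p)⁻¹ * dist (AA φ y) (AA φ t)) (nhds t) (nhds 0) := by
    have := (tendsto_iff_dist_tendsto_zero.1 hA).const_mul (((t/2)^p)⁻¹)
    simpa using this
  refine squeeze_zero' (Eventually.of_forall fun _ => dist_nonneg) ?_ h1
  have key : ∀ a b, t/2 < a → a ≤ b → dist (BB p φ a) (BB p φ b) ≤
      ((t/2)^p)⁻¹ * dist (AA φ a) (AA φ b) := by
    intro a b ha hab
    have ha0 : 0 < a := by linarith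
    have e1 := H.ABle a b ha0 hab
    have e2 := H.Amono a b ha0 hab
    have e3 := H.Banti a b ha0 hab
    rw [Real.dist_eq, Real.dist_eq, abs_of_nonneg (by linarith), abs_sub_comm,
      abs_of_nonneg (by linarith), ← div_eq_inv_mul, le_div_iff₀ hc, mul_comm]
    refine le_trans ?_ e1
    have : (t/2)^p ≤ a^p := Real.rpow_le_rpow (by linarith) ha.le (by linarith [H.hp])
    apply mul_le_mul_of_nonneg_right this (by linarith)
  filter_upwards [Ioi_mem_nhds (show t/2 < t by linarith)] with y hy
  rcases le_total y t with h | h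
  · exact key y t hy h
  · rw [dist_comm, dist_comm (AA φ y)]; exact key t y (by linarith) h

lemma hD (H : Hyp p φ) (t : ℝ) (ht : 0 < t) :
    HasDerivAt (Df p (AA φ) (BB p φ)) (dd p (BB p φ) t) t := by
  have hp := H.hp
  have hpow := Real.hasDerivAt_rpow_const (x := t) (p := p) (Or.inl ht.ne')
  have h0 : HasDerivAt (fun y => y ^ p * BB p φ t) (dd p (BB p φ) t) t := by
    have := hpow.mul_const (BB p φ t)
    exact this
  have h1 : HasDerivAt (fun y => Df p (AA φ) (BB p φ) y - y ^ p * BB p φ t) 0 t := by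
    rw [hasDerivAt_iff_isLittleO]
    simp only [smul_zero, sub_zero]
    have hB : (fun y => BB p φ y - BB p φ t) =o[nhds t] (fun _ => (1:ℝ)) := by
      rw [Asymptotics.isLittleO_one_iff]
      have := (H.Bcont.continuousAt (Ioi_mem_nhds ht)).sub_const (BB p φ t)
      simpa using this
    have hO : (fun y => y ^ p - t ^ p) =O[nhds t] (fun y => y - t) := hpow.differentiableAt.isBigO_sub
    have hm := hO.mul_isLittleO hB
    simp only [mul_one] at hm
    refine Asymptotics.IsBigO.trans_isLittleO ?_ hm
    apply Asymptotics.IsBigO.of_bound 1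
    filter_upwards [Ioi_mem_nhds ht] with y hy'
    have hy : 0 < y := hy'
    rw [one_mul, Real.norm_eq_abs, Real.norm_eq_abs, abs_mul]
    unfold Df
    rcases le_total y t with h | h
    · have e1 := H.ABle y t hy h
      have e2 := H.leAB y t hy h
      have e3 := H.Banti y t hy h
      have e4 : y ^ p ≤ t ^ p := Real.rpow_le_rpow hy.le h (by linarith)
      rw [abs_of_nonpos (show y ^ p - t ^ p ≤ 0 by linarith), abs_of_nonneg (show 0 ≤ BB p φ y - BB p φ t by linarith), abs_le]
      constructor <;> nlinarith
    · have e1 := H.ABle t y ht h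
      have e2 := H.leAB t y ht h
      have e3 := H.Banti t y ht h
      have e4 : t ^ p ≤ y ^ p := Real.rpow_le_rpow ht.le h (by linarith)
      rw [abs_of_nonneg (show 0 ≤ y ^ p - t ^ p by linarith), abs_of_nonpos (show BB p φ y - BB p φ t ≤ 0 by linarith), abs_le]
      constructor <;> nlinarith
  have := h1.add h0
  rw [zero_add] at this
  refine this.congr_of_eventuallyEq (Eventually.of_forall fun y => ?_)
  simp

lemma zcont (H : Hyp p φ) : ContinuousOn (zf p (AA φ) (BB p φ)) (Ioi 0) := by
  have hD : ContinuousOn (Df p (AA φ) (BB p φ)) (Ioi 0) := fun t ht =>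
    (H.hD t ht).continuousAt.continuousWithinAt
  refine (((Setup.contPow (p-1)).mul H.Acont).mul H.Bcont).div (hD.pow 2) (fun x hx => ?_)
  have h1 := H.Apos x hx
  have h2 := H.Bpos x hx
  have hx0 : 0 < x := hx
  have : 0 < Df p (AA φ) (BB p φ) x := by unfold Df; positivity
  positivity

lemma hZ (H : Hyp p φ) (t : ℝ) (ht : 0 < t) : HasDerivAt (ZZ p φ) (zf p (AA φ) (BB p φ) t) t := by
  have h1 : IntervalIntegrable (zf p (AA φ) (BB p φ)) volume 1 t := by
    apply ContinuousOn.intervalIntegrable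
    apply H.zcont.mono
    intro x hx
    rw [mem_uIcc] at hx
    show 0 < x
    rcases hx with h | h
    · linarith [h.1]
    · linarith [h.1]
  have h2 := intervalIntegral.integral_hasDerivAt_right h1
    (H.zcont.stronglyMeasurableAtFilter isOpen_Ioi t ht) (H.zcont.continuousAt (Ioi_mem_nhds ht))
  refine h2.congr_of_eventuallyEq ?_
  filter_upwards [Ioi_mem_nhds ht] with y hy
  unfold ZZ
  rw [piecewise_eq_of_mem _ _ _ hy]

lemma mZ (H : Hyp p φ) : Measurable (ZZ p φ) := by
  have hc : ContinuousOn (ZZ p φ) (Ioi 0) := fun t ht =>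
    (H.hZ t ht).continuousAt.continuousWithinAt
  unfold ZZ at hc ⊢
  apply ContinuousOn.measurable_piecewise
  · refine hc.congr fun y hy => ?_
    rw [piecewise_eq_of_mem _ _ _ hy]
  · exact continuousOn_const
  · exact measurableSet_Ioi

lemma mA : Measurable (AA φ) := by
  unfold AA
  have : Monotone (intPhi φ) := fun a b hab => lintegral_mono_set (Ioo_subset_Ioo_right hab)
  exact this.measurable.ennreal_toReal

lemma mB : Measurable (BB p φ) := by
  unfold BB
  have : Antitone (tailP ⊤ p φ) := fun a b hab => by
    rw [tailEq, tailEq]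
    exact lintegral_mono_set (Ioi_subset_Ioi hab)
  exact this.measurable.ennreal_toReal

lemma Atop (H : Hyp p φ) : Tendsto (AA φ) atTop atTop := by
  have h1 : Tendsto (fun n : ℕ => (volume.withDensity φ) (Ioo 0 ((n:ℝ)+1))) atTop
      (nhds ((volume.withDensity φ) (⋃ n : ℕ, Ioo (0:ℝ) ((n:ℝ)+1)))) := by
    apply tendsto_measure_iUnion_atTop
    intro a b hab
    have : (a:ℝ) ≤ b := by exact_mod_cast hab
    exact Ioo_subset_Ioo_right (by linarith)
  have h2 : (⋃ n : ℕ, Ioo (0:ℝ) ((n:ℝ)+1)) = Ioi 0 := by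
    ext x
    simp only [mem_iUnion, mem_Ioo, mem_Ioi]
    constructor
    · rintro ⟨n, h⟩; exact h.1
    · intro h
      obtain ⟨n, hn⟩ := exists_nat_gt x
      exact ⟨n, h, by linarith⟩
  rw [h2, withDensity_apply _ measurableSet_Ioi, H.inf] at h1
  rw [tendsto_atTop]
  intro K
  obtain ⟨n, hn⟩ := (h1.eventually (lt_mem_nhds (ENNReal.ofReal_lt_top (r := K)))).exists
  rw [withDensity_apply _ measurableSet_Ioo] at hn
  have hn0 : (0:ℝ) < (n:ℝ)+1 := by positivity
  filter_upwards [eventually_ge_atTop ((n:ℝ)+1)] with t ht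
  refine le_trans ?_ (H.Amono _ _ hn0 ht)
  exact (ENNReal.ofReal_le_iff_le_toReal (H.afin _ hn0).ne).1 hn.le

lemma Bzero (H : Hyp p φ) : Tendsto (BB p φ) (nhdsWithin 0 (Ioi 0)) atTop := by
  have h1 : Tendsto (fun n : ℕ => (volume.withDensity (fun s => φ s * ENNReal.ofReal (s ^ (-p))))
      (Ioi (1/((n:ℝ)+1)))) atTop
      (nhds ((volume.withDensity (fun s => φ s * ENNReal.ofReal (s ^ (-p))))
        (⋃ n : ℕ, Ioi (1/((n:ℝ)+1))))) := by
    apply tendsto_measure_iUnion_atTop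
    intro a b hab
    have : (a:ℝ) ≤ b := by exact_mod_cast hab
    apply Ioi_subset_Ioi
    gcongr
  have h2 : (⋃ n : ℕ, Ioi (1/((n:ℝ)+1))) = Ioi 0 := by
    ext x
    simp only [mem_iUnion, mem_Ioi]
    constructor
    · rintro ⟨n, h⟩
      exact lt_trans (by positivity) h
    · intro h
      exact exists_nat_one_div_lt h
  rw [h2, withDensity_apply _ measurableSet_Ioi, ← tailEq, H.tail0] at h1
  rw [tendsto_atTop]
  intro K
  obtain ⟨n, hn⟩ := (h1.eventually (lt_mem_nhds (ENNReal.ofReal_lt_top (r := K)))).exists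
  rw [withDensity_apply _ measurableSet_Ioi, ← tailEq] at hn
  have hn0 : (0:ℝ) < 1/((n:ℝ)+1) := by positivity
  filter_upwards [Ioc_mem_nhdsGT hn0] with t ht
  refine le_trans ?_ (H.Banti _ _ ht.1 ht.2)
  exact (ENNReal.ofReal_le_iff_le_toReal (H.tfin _ hn0).ne).1 hn.le

lemma intm (H : Hyp p φ) (h : ℝ → ℝ≥0∞) (hh : Measurable h) {s : Set ℝ} (hs : MeasurableSet s)
    (hs0 : s ⊆ Ioi 0) : ∫⁻ t in s, h t ∂(mM φ) = ∫⁻ t in s, φ t * h t := by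
  unfold mM
  rw [restrict_withDensity hs, Measure.restrict_restrict hs, inter_eq_left.2 hs0,
    lintegral_withDensity_eq_lintegral_mul _ H.mφ hh]
  rfl

lemma setup (H : Hyp p φ) : Setup p (mM φ) (AA φ) (BB p φ) (ZZ p φ) where
  hp := H.hp
  hm0 := by
    have h : (volume.restrict (Ioi (0:ℝ))) (Iic 0) = 0 := by
      rw [Measure.restrict_apply measurableSet_Iic, Iic_inter_Ioi, Ioc_self, measure_empty]
    exact withDensity_absolutelyContinuous _ _ h
  mA := mA
  mB := mB
  mZ := H.mZ
  Apos := H.Apos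
  Bpos := H.Bpos
  hA := by
    intro t ht
    unfold AA
    rw [ENNReal.ofReal_toReal (H.afin t ht).ne, ← setLIntegral_one,
      H.intm (fun _ => 1) (by fun_prop) measurableSet_Ioo Ioo_subset_Ioi_self]
    simp [intPhi]
  hB := by
    intro t ht
    unfold BB
    rw [ENNReal.ofReal_toReal (H.tfin t ht).ne,
      H.intm _ (by fun_prop) measurableSet_Ioi (Ioi_subset_Ioi ht.le), tailEq]
  Acont := H.Acont
  Bcont := H.Bcont
  Amono := H.Amono
  Banti := H.Banti
  hD := H.hD
  hZ := H.hZ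
  Atop := H.Atop
  Bzero := H.Bzero

end Hyp

lemma TgSop (g : ℝ → ℝ≥0∞) {s : ℝ} (hs : 0 < s) : Tg g s = ENNReal.ofReal s * Sop g s := by
  unfold Tg Sop
  rw [← lintegral_const_mul' _ _ ENNReal.ofReal_ne_top]
  apply setLIntegral_congr_fun measurableSet_Ioi
  intro t ht'
  have ht : 0 < t := ht'
  simp only
  rw [add_comm t s, ENNReal.ofReal_div_of_pos (by positivity), div_eq_mul_inv, div_eq_mul_inv]
  ring

namespace Hyp
variable {p : ℝ} {φ : ℝ → ℝ≥0∞}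

lemma dual (H : Hyp p φ) {s : ℝ} (hs : 0 < s) :
    dualWeight ⊤ p φ s = ENNReal.ofReal (zf p (AA φ) (BB p φ) s *
      (s ^ (p/(p-1)) * Df p (AA φ) (BB p φ) s ^ (1 - p/(p-1)))) := by
  have hA := H.Apos s hs
  have hB := H.Bpos s hs
  have hD := H.setup.Dpos hs
  have eA : intPhi φ s = ENNReal.ofReal (AA φ s) := (ENNReal.ofReal_toReal (H.afin s hs).ne).symm
  have eB : tailP ⊤ p φ s = ENNReal.ofReal (BB p φ s) := (ENNReal.ofReal_toReal (H.tfin s hs).ne).symm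
  have eD : DPhi ⊤ p φ s = ENNReal.ofReal (Df p (AA φ) (BB p φ) s) := by
    unfold DPhi Df
    rw [eA, eB, ENNReal.ofReal_add hA.le (by positivity), ENNReal.ofReal_mul (by positivity)]
  unfold dualWeight
  rw [eD, eA, eB, ENNReal.ofReal_rpow_of_pos hD, ← ENNReal.ofReal_mul (by positivity),
    ← ENNReal.ofReal_mul (by positivity), ← ENNReal.ofReal_div_of_pos (by positivity)]
  congr 1
  unfold zf
  set q := p/(p-1)
  set D := Df p (AA φ) (BB p φ) s
  have e1 : s ^ (p + q - 1) = s ^ (p - 1) * s ^ q := by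
    rw [← Real.rpow_add hs]; congr 1; ring
  have e2 : D ^ (q + 1) * D ^ (1 - q) = D ^ 2 := by
    rw [← Real.rpow_add hD, ← Real.rpow_natCast]; congr 1; push_cast; ring
  rw [e1, div_eq_iff (by positivity)]
  calc _ = s ^ (p - 1) * s ^ q * AA φ s * BB p φ s * (D^2 / D^2) := by
        rw [div_self (by positivity), mul_one]
    _ = s ^ (p - 1) * s ^ q * AA φ s * BB p φ s * ((D ^ (q + 1) * D ^ (1 - q)) / D^2) := by rw [e2]
    _ = _ := by ring

lemma link (H : Hyp p φ) (g : ℝ → ℝ≥0∞) (hg : Measurable g) :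
    ∫⁻ t in Ioi (0 : ℝ), (Sop g t) ^ (p / (p - 1)) * dualWeight ⊤ p φ t =
    ∫⁻ s, (ENNReal.ofReal (Df p (AA φ) (BB p φ) s ^ (-(1/p))) * Tg g s) ^ (p/(p-1))
      ∂(nuM p (AA φ) (BB p φ)) := by
  have S := H.setup
  have hmD := S.mD
  have mT := measTg g hg
  have hp := H.hp
  have hp1 : 0 < p - 1 := by linarith
  have hp0 : 0 < p := by linarith
  rw [S.lnu _ (by fun_prop)]
  apply setLIntegral_congr_fun measurableSet_Ioi
  intro s hs'
  have hs : 0 < s := hs'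
  have hD := S.Dpos hs
  have hz := S.zpos hs
  have hq : 0 < p/(p-1) := by positivity
  simp only
  rw [H.dual hs, TgSop g hs, ENNReal.mul_rpow_of_nonneg _ _ hq.le,
    ENNReal.mul_rpow_of_nonneg _ _ hq.le, ENNReal.ofReal_rpow_of_pos hs,
    ENNReal.ofReal_rpow_of_pos (by positivity), ← Real.rpow_mul hD.le,
    ENNReal.ofReal_mul hz.le, ENNReal.ofReal_mul (by positivity)]
  rw [show -(1/p) * (p/(p-1)) = 1 - p/(p-1) by field_simp; ring]
  ring

lemma N_zero (H : Hyp p φ) (f : ℝ → ℝ≥0∞) (hf1 : AntitoneOn f (Ioi 0))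
    (hN : ∫⁻ t in Ioi (0 : ℝ), f t ^ p * φ t = 0) {t : ℝ} (ht : 0 < t) : f t = 0 := by
  have hp : 0 < p := by linarith [H.hp]
  have h1 : f t ^ p * intPhi φ t ≤ ∫⁻ t in Ioi (0 : ℝ), f t ^ p * φ t := by
    unfold intPhi
    rw [← lintegral_const_mul _ H.mφ]
    refine (setLIntegral_mono' measurableSet_Ioo ?_).trans
      (lintegral_mono_set Ioo_subset_Ioi_self)
    intro u hu
    gcongr
    exact hf1 hu.1 ht hu.2.le
  rw [hN] at h1
  have h2 := le_zero_iff.1 h1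
  rcases mul_eq_zero.1 h2 with h | h
  · exact (ENNReal.rpow_eq_zero_iff_of_pos hp).1 h
  · have := H.Apos t ht
    unfold AA at this
    rw [h] at this
    simp at this

lemma main (H : Hyp p φ) :
    ∃ c C : ℝ, 0 < c ∧ 0 < C ∧ ∀ g : ℝ → ℝ≥0∞, Measurable g →
      ENNReal.ofReal c *
          (∫⁻ t in Ioi (0 : ℝ), (Sop g t) ^ (p / (p - 1)) * dualWeight ⊤ p φ t) ^
            (1 / (p / (p - 1))) ≤
        (⨆ (f : ℝ → ℝ≥0∞) (_ : Measurable f) (_ : AntitoneOn f (Ioi 0))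
            (_ : MonotoneOn (fun t => ENNReal.ofReal t * f t) (Ioi 0)),
          (∫⁻ t in Ioi (0 : ℝ), f t * g t) / (∫⁻ t in Ioi (0 : ℝ), f t ^ p * φ t) ^ (1 / p)) ∧
      (⨆ (f : ℝ → ℝ≥0∞) (_ : Measurable f) (_ : AntitoneOn f (Ioi 0))
            (_ : MonotoneOn (fun t => ENNReal.ofReal t * f t) (Ioi 0)),
          (∫⁻ t in Ioi (0 : ℝ), f t * g t) / (∫⁻ t in Ioi (0 : ℝ), f t ^ p * φ t) ^ (1 / p)) ≤
        ENNReal.ofReal C *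
          (∫⁻ t in Ioi (0 : ℝ), (Sop g t) ^ (p / (p - 1)) * dualWeight ⊤ p φ t) ^
            (1 / (p / (p - 1))) := by
  have S := H.setup
  have hp0 : 0 < p := S.p0
  have hpq : p.HolderConjugate (p/(p-1)) := (Real.holderConjugate_iff_eq_conjExponent H.hp).2 rfl
  obtain ⟨C, hC, hup⟩ := S.upper hpq
  obtain ⟨C1, hC1, hlow⟩ := S.lower hpq
  have eN : ∀ f : ℝ → ℝ≥0∞, Measurable f →
      ∫⁻ t in Ioi 0, f t ^ p ∂(mM φ) = ∫⁻ t in Ioi (0 : ℝ), f t ^ p * φ t := by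
    intro f hf
    rw [H.intm _ (by fun_prop) measurableSet_Ioi subset_rfl]
    simp_rw [mul_comm]
  refine ⟨1/C1, C, by positivity, hC, fun g hg => ⟨?_, ?_⟩⟩
  · rw [H.link g hg]
    set M := (⨆ (f : ℝ → ℝ≥0∞) (_ : Measurable f) (_ : AntitoneOn f (Ioi 0))
            (_ : MonotoneOn (fun t => ENNReal.ofReal t * f t) (Ioi 0)),
          (∫⁻ t in Ioi (0 : ℝ), f t * g t) / (∫⁻ t in Ioi (0 : ℝ), f t ^ p * φ t) ^ (1 / p)) with hM
    have h1 := hlow g hg M (by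
      intro f hf hf1 hf2 hfin
      rw [eN f hf] at hfin ⊢
      rcases eq_or_ne (∫⁻ t in Ioi (0 : ℝ), f t ^ p * φ t) 0 with h0 | h0
      · have : ∫⁻ t in Ioi (0:ℝ), f t * g t = ∫⁻ t in Ioi (0:ℝ), 0 := by
          apply setLIntegral_congr_fun measurableSet_Ioi
          intro t ht
          simp only
          rw [H.N_zero f hf1 h0 ht, zero_mul]
        rw [this]; simp
      · have h2 : (∫⁻ t in Ioi (0 : ℝ), f t * g t) /
            (∫⁻ t in Ioi (0 : ℝ), f t ^ p * φ t) ^ (1 / p) ≤ M :=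
          le_iSup_of_le f (le_iSup_of_le hf (le_iSup_of_le hf1 (le_iSup_of_le hf2 le_rfl)))
        refine (ENNReal.div_le_iff ?_ ?_).1 h2
        · rw [Ne, ENNReal.rpow_eq_zero_iff_of_pos (by positivity)]; exact h0
        · exact ENNReal.rpow_ne_top_of_nonneg (by positivity) hfin)
    calc _ ≤ ENNReal.ofReal (1/C1) * (ENNReal.ofReal C1 * M) := by gcongr
      _ = M := by
        rw [← mul_assoc, ← ENNReal.ofReal_mul (by positivity), one_div_mul_cancel hC1.ne']
        simp
  · rw [H.link g hg]
    refine iSup_le fun f => iSup_le fun hf => iSup_le fun hf1 => iSup_le fun hf2 => ?_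
    apply ENNReal.div_le_of_le_mul
    rw [← eN f hf]
    exact hup f g hf hg hf1 hf2

end Hyp

theorem statement10 (p : ℝ) (hp : 1 < p) (φ : ℝ → ℝ≥0∞)
    (hφ : IsNontrivialWeight ⊤ p φ) (hphiInf : ∫⁻ t in Ioi (0 : ℝ), φ t = ⊤) :
    ∃ c C : ℝ, 0 < c ∧ 0 < C ∧ ∀ g : ℝ → ℝ≥0∞, Measurable g →
      ENNReal.ofReal c *
          (∫⁻ t in Ioi (0 : ℝ), (Sop g t) ^ (p / (p - 1)) * dualWeight ⊤ p φ t) ^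
            (1 / (p / (p - 1))) ≤
        (⨆ (f : ℝ → ℝ≥0∞) (_ : Measurable f) (_ : AntitoneOn f (Ioi 0))
            (_ : MonotoneOn (fun t => ENNReal.ofReal t * f t) (Ioi 0)),
          (∫⁻ t in Ioi (0 : ℝ), f t * g t) / (∫⁻ t in Ioi (0 : ℝ), f t ^ p * φ t) ^ (1 / p)) ∧
      (⨆ (f : ℝ → ℝ≥0∞) (_ : Measurable f) (_ : AntitoneOn f (Ioi 0))
            (_ : MonotoneOn (fun t => ENNReal.ofReal t * f t) (Ioi 0)),
          (∫⁻ t in Ioi (0 : ℝ), f t * g t) / (∫⁻ t in Ioi (0 : ℝ), f t ^ p * φ t) ^ (1 / p)) ≤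
        ENNReal.ofReal C *
          (∫⁻ t in Ioi (0 : ℝ), (Sop g t) ^ (p / (p - 1)) * dualWeight ⊤ p φ t) ^
            (1 / (p / (p - 1))) := by
  classical
  obtain ⟨⟨mφ, hpos, hloc⟩, htail, h0⟩ := hφ
  have hloc' : ∀ a c : ℝ, 0 < a → ∫⁻ t in Icc a c, φ t < ⊤ :=
    fun a c ha => hloc a c ha ENNReal.ofReal_lt_top
  have hpos' : ∀ t, 0 < t → 0 < φ t := fun t ht => (hpos t ⟨ht, ENNReal.ofReal_lt_top⟩).1
  by_cases hfin : ∀ t, 0 < t → intPhi φ t < ⊤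
  · exact Hyp.main ⟨hp, mφ, hpos', hloc', htail rfl, h0, hfin, hphiInf⟩
  · push Not at hfin
    obtain ⟨t0, ht0, htop⟩ := hfin
    have htop0 : intPhi φ t0 = ⊤ := top_le_iff.1 htop
    have hall : ∀ t, 0 < t → intPhi φ t = ⊤ := by
      intro t ht
      rcases le_total t t0 with h | h
      · have e := Hyp.A_add (φ := φ) t t0 ht h
        rw [htop0] at e
        rcases ENNReal.add_eq_top.1 e.symm with h1 | h1
        · exact h1
        · exact absurd h1 ((lintegral_mono_set Ioc_subset_Icc_self).trans_lt (hloc' t t0 ht)).ne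
      · rw [Hyp.A_add (φ := φ) t0 t ht0 h, htop0]; simp
    have hp0 : 0 < p := by linarith
    have hp1 : 0 < p - 1 := by linarith
    refine ⟨1, 1, one_pos, one_pos, fun g hg => ?_⟩
    have hz : ∫⁻ t in Ioi (0 : ℝ), (Sop g t) ^ (p / (p - 1)) * dualWeight ⊤ p φ t = 0 := by
      have : ∫⁻ t in Ioi (0 : ℝ), (Sop g t) ^ (p / (p - 1)) * dualWeight ⊤ p φ t =
          ∫⁻ t in Ioi (0 : ℝ), 0 := by
        apply setLIntegral_congr_fun measurableSet_Ioi
        intro t ht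
        have hD : DPhi ⊤ p φ t = ⊤ := by unfold DPhi; rw [hall t ht]; simp
        have : dualWeight ⊤ p φ t = 0 := by
          unfold dualWeight
          rw [hD, ENNReal.top_rpow_of_pos (by positivity), ENNReal.div_top]
        simp only
        rw [this, mul_zero]
      rw [this]; simp
    rw [hz, ENNReal.zero_rpow_of_pos (by positivity), mul_zero]
    refine ⟨zero_le, ?_⟩
    refine iSup_le fun f => iSup_le fun hf => iSup_le fun hf1 => iSup_le fun hf2 => ?_
    rw [le_zero_iff]
    by_cases hf0 : ∀ t, 0 < t → f t = 0
    · have : ∫⁻ t in Ioi (0:ℝ), f t * g t = ∫⁻ t in Ioi (0:ℝ), 0 := by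
        apply setLIntegral_congr_fun measurableSet_Ioi
        intro t ht
        simp only
        rw [hf0 t ht, zero_mul]
      rw [this]; simp
    · push Not at hf0
      obtain ⟨t, ht, hne⟩ := hf0
      have h1 : f t ^ p * intPhi φ t ≤ ∫⁻ t in Ioi (0 : ℝ), f t ^ p * φ t := by
        unfold intPhi
        rw [← lintegral_const_mul _ mφ]
        refine (setLIntegral_mono' measurableSet_Ioo ?_).trans
          (lintegral_mono_set Ioo_subset_Ioi_self)
        intro u hu
        gcongr
        exact hf1 hu.1 ht hu.2.le
      rw [hall t ht, ENNReal.mul_top (by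
        rw [Ne, ENNReal.rpow_eq_zero_iff_of_pos hp0]; exact hne)] at h1
      rw [top_le_iff.1 h1, ENNReal.top_rpow_of_pos (by positivity), ENNReal.div_top]

end
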